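/- arXiv:2103.05725 — 2 statements merged into one kernel-verified Lean document; each statement's English description precedes it below -/
import Mathlib

section
/- Let Y be a nonempty zero-dimensional Polish space without isolated points. Then: (1) if X is a first countable Hausdorff space with |X| ≤ 𝔠, then X is Y-partitionable if and only if X is Y-coverable; (2) if X is a metrizable space with |X| ≤ 𝔠^{+ω}, then X is Y-partitionable if and only if X is Y-coverable; (3) if X is a completely metrizable space, then X is Y-partitionable if and only if X is Y-coverable, if and only if X has no isolated points. -/
open Cardinal Set TopologicalSpace

/-- The Cantor space `2^ω`. -/
abbrev CantorSpace : Type := ℕ → Bool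

/-- `X` is `Y`-coverable: there is a family of subspaces of `X`, each homeomorphic to `Y`,
whose union is `X`. -/
def Coverable (X Y : Type*) [TopologicalSpace X] [TopologicalSpace Y] : Prop :=
  ∃ C : Set (Set X), (∀ K ∈ C, Nonempty (K ≃ₜ Y)) ∧ ⋃₀ C = Set.univ

/-- `X` is `Y`-partitionable: there is a partition of `X` into pairwise disjoint subspaces,
each homeomorphic to `Y`. -/
def Partitionable (X Y : Type*) [TopologicalSpace X] [TopologicalSpace Y] : Prop :=
  ∃ P : Set (Set X), (∀ K ∈ P, Nonempty (K ≃ₜ Y)) ∧ P.PairwiseDisjoint id ∧ ⋃₀ P = Set.univ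

/-- A packing of copies of `Y` into `X`: a pairwise disjoint family of subspaces of `X`,
each homeomorphic to `Y`. -/
def IsPacking {X : Type*} [TopologicalSpace X] (Y : Type*) [TopologicalSpace Y]
    (Q : Set (Set X)) : Prop :=
  (∀ K ∈ Q, Nonempty (K ≃ₜ Y)) ∧ Q.PairwiseDisjoint id
/-- A topological space is completely metrizable if its topology is induced by some
complete metric. -/
def CompletelyMetrizable (X : Type*) [t : TopologicalSpace X] : Prop :=
  ∃ m : MetricSpace X, m.toUniformSpace.toTopologicalSpace = t ∧
    @CompleteSpace X m.toUniformSpace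

/-- `𝔠^{+ω}`, the least limit cardinal above `𝔠`: the supremum of the finitely iterated
cardinal successors of `𝔠`. -/
noncomputable def contSuccOmega : Cardinal.{u} :=
  ⨆ n : ℕ, (Order.succ)^[n] Cardinal.continuum

section Auxiliary

open Topology

universe u

/-- A subset of `X` is a copy of `Y` if it is the range of an embedding of `Y`. -/
def IsCopy (Y : Type*) [TopologicalSpace Y] {X : Type*} [TopologicalSpace X] (K : Set X) : Prop :=
  ∃ f : Y → X, IsEmbedding f ∧ range f = K

/-- A subset of `X` that can be partitioned into copies of `Y`. -/
def IsPartitionableSet (Y : Type*) [TopologicalSpace Y] {X : Type*} [TopologicalSpace X]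
    (A : Set X) : Prop :=
  ∃ P : Set (Set X), (∀ K ∈ P, IsCopy Y K) ∧ P.PairwiseDisjoint id ∧ ⋃₀ P = A

section Copies

variable {X Y Z : Type*} [TopologicalSpace X] [TopologicalSpace Y] [TopologicalSpace Z]

theorem nonempty_homeomorph_iff_isCopy {K : Set X} : Nonempty (K ≃ₜ Y) ↔ IsCopy Y K := by
  constructor
  · rintro ⟨e⟩
    refine ⟨fun y => (e.symm y : X), IsEmbedding.subtypeVal.comp e.symm.isEmbedding, ?_⟩
    rw [show (fun y => (e.symm y : X)) = Subtype.val ∘ e.symm from rfl, range_comp,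
      e.symm.surjective.range_eq, image_univ, Subtype.range_coe]
  · rintro ⟨f, hf, rfl⟩
    exact ⟨hf.toHomeomorph.symm⟩

theorem IsCopy.image {K : Set X} (h : IsCopy Y K) {e : X → Z} (he : IsEmbedding e) :
    IsCopy Y (e '' K) := by
  obtain ⟨f, hf, rfl⟩ := h
  exact ⟨e ∘ f, he.comp hf, range_comp _ _⟩

theorem IsCopy.nonempty [Nonempty Y] {K : Set X} (h : IsCopy Y K) : K.Nonempty := by
  obtain ⟨f, -, rfl⟩ := h
  exact range_nonempty f

theorem IsCopy.isPartitionableSet {K : Set X} (h : IsCopy Y K) : IsPartitionableSet Y K :=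
  ⟨{K}, by simpa using h, pairwiseDisjoint_singleton _ _, sUnion_singleton _⟩

theorem IsPartitionableSet.image {A : Set X} (h : IsPartitionableSet Y A) {e : X → Z}
    (he : IsEmbedding e) : IsPartitionableSet Y (e '' A) := by
  obtain ⟨P, hP, hd, rfl⟩ := h
  refine ⟨(e '' ·) '' P, ?_, ?_, ?_⟩
  · rintro _ ⟨K, hK, rfl⟩
    exact (hP K hK).image he
  · rintro _ ⟨K, hK, rfl⟩ _ ⟨L, hL, rfl⟩ hne
    exact (disjoint_image_iff he.injective).2 (hd hK hL fun h => hne (by rw [h]))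
  · rw [sUnion_image, image_sUnion, sUnion_image]

theorem IsPartitionableSet.iUnion {ι : Type*} {A : ι → Set X}
    (h : ∀ i, IsPartitionableSet Y (A i)) (hd : Pairwise fun i j => Disjoint (A i) (A j)) :
    IsPartitionableSet Y (⋃ i, A i) := by
  choose P hP hPd hPA using h
  refine ⟨⋃ i, P i, ?_, ?_, ?_⟩
  · intro K hK
    obtain ⟨i, hi⟩ := mem_iUnion.1 hK
    exact hP i K hi
  · intro K hK L hL hne
    obtain ⟨i, hi⟩ := mem_iUnion.1 hK
    obtain ⟨j, hj⟩ := mem_iUnion.1 hL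
    rcases eq_or_ne i j with rfl | hij
    · exact hPd i hi hj hne
    · refine (hd hij).mono ?_ ?_
      · rw [← hPA i]
        exact subset_sUnion_of_mem hi
      · rw [← hPA j]
        exact subset_sUnion_of_mem hj
  · rw [sUnion_iUnion]
    exact iUnion_congr hPA

theorem IsPartitionableSet.union {A B : Set X} (hA : IsPartitionableSet Y A)
    (hB : IsPartitionableSet Y B) (hd : Disjoint A B) : IsPartitionableSet Y (A ∪ B) := by
  rw [union_eq_iUnion]
  refine IsPartitionableSet.iUnion (fun b => by cases b <;> assumption) ?_
  intro a b hab
  cases a <;> cases b <;> simp_all [disjoint_comm]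

theorem IsPartitionableSet.trans {A : Set X} (hA : IsPartitionableSet Z A)
    (hZ : IsPartitionableSet Y (univ : Set Z)) : IsPartitionableSet Y A := by
  obtain ⟨P, hP, hd, rfl⟩ := hA
  rw [sUnion_eq_iUnion]
  refine IsPartitionableSet.iUnion (fun K => ?_)
    fun K L hKL => hd K.2 L.2 fun h => hKL (Subtype.ext h)
  obtain ⟨f, hf, hfK⟩ := hP K K.2
  rw [← hfK, ← image_univ]
  exact hZ.image hf

theorem partitionable_iff : Partitionable X Y ↔ IsPartitionableSet Y (univ : Set X) := by
  simp only [Partitionable, IsPartitionableSet, nonempty_homeomorph_iff_isCopy]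

theorem Partitionable.coverable (h : Partitionable X Y) : Coverable X Y := by
  obtain ⟨P, hP, -, hU⟩ := h
  exact ⟨P, hP, hU⟩

theorem Continuous.isCopy_range [CompactSpace Y] [T2Space X] {f : Y → X} (hf : Continuous f)
    (hi : Function.Injective f) : IsCopy Y (range f) :=
  ⟨f, (hf.isClosedEmbedding hi).isEmbedding, rfl⟩

end Copies

section Recursion

/-- A family of sets, each at least as large as the index type, has an injective choice
function. -/
theorem exists_injective_forall_mem_of_mk_le {I S : Type u} (A : I → Set S)
    (hA : ∀ i, #I ≤ #(A i)) : ∃ f : I → S, Function.Injective f ∧ ∀ i, f i ∈ A i := by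
  obtain ⟨_, _, ho⟩ := exists_ord_eq_type_lt I
  have key : ∀ i (g : {j // j < i} → S), ∃ s ∈ A i, s ∉ range g := by
    intro i g
    by_contra! h
    have h1 : #(A i) ≤ #(range g) := mk_le_mk_of_subset h
    exact absurd ((hA i).trans (h1.trans mk_range_le)) (not_le.2 (mk_Iio_lt i ho))
  choose F hF hF' using key
  let f : I → S := wellFounded_lt.fix fun i g => F i fun j => g j.1 j.2
  have hf : ∀ i, f i = F i fun j => f j.1 := fun i => wellFounded_lt.fix_eq _ i
  refine ⟨f, ?_, fun i => hf i ▸ hF _ _⟩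
  have hne : ∀ i j, j < i → f j ≠ f i := by
    intro i j hji h
    have := hF' i fun j => f j.1
    rw [← hf] at this
    exact this ⟨⟨j, hji⟩, h⟩
  intro i j hij
  rcases lt_trichotomy i j with h | h | h
  · exact absurd hij (hne _ _ h)
  · exact h
  · exact absurd hij.symm (hne _ _ h)

/-- If the sets of a family of infinite sets only meet few other members, all of the same
prescribed size `m i`, then the family has an injective choice function. -/
theorem exists_injective_forall_mem_of_mk_inter_le {I S : Type u} (A : I → Set S)
    (m : I → Cardinal.{u}) (hm : ∀ i, ℵ₀ ≤ m i) (hA : ∀ i, m i ≤ #(A i))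
    (heq : ∀ i j, (A i ∩ A j).Nonempty → m i = m j)
    (hle : ∀ i, #{j | (A i ∩ A j).Nonempty} ≤ m i) :
    ∃ f : I → S, Function.Injective f ∧ ∀ i, f i ∈ A i := by
  let N : I → Set I := fun i => {j | (A i ∩ A j).Nonempty}
  obtain ⟨T, hT0, hTs⟩ : ∃ T : I → ℕ → Set I,
      (∀ i, T i 0 = {i}) ∧ ∀ i n, T i (n + 1) = ⋃ j ∈ T i n, N j :=
    ⟨fun i n => Nat.rec {i} (fun _ s => ⋃ j ∈ s, N j) n, fun _ => rfl, fun _ _ => rfl⟩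
  have hT : ∀ i n, ∀ j ∈ T i n, m j = m i := by
    intro i n
    induction n with
    | zero =>
      intro j hj
      rw [hT0, mem_singleton_iff] at hj
      rw [hj]
    | succ n ih =>
      intro j hj
      rw [hTs] at hj
      obtain ⟨k, hk, hkj⟩ := mem_iUnion₂.1 hj
      exact (heq _ _ hkj).symm.trans (ih k hk)
  have hTc : ∀ i n, #↥(T i n) ≤ m i := by
    intro i n
    induction n with
    | zero => exact hT0 i ▸ (mk_singleton i).trans_le (one_le_aleph0.trans (hm i))
    | succ n ih =>
      rw [hTs]
      refine (mk_biUnion_le _ _).trans ((mul_le_mul' ih ?_).trans (mul_eq_self (hm i)).le)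
      exact ciSup_le' fun j => (hle j).trans (hT i n j j.2).le
  let E : Setoid I := Relation.EqvGen.setoid fun i j => (A i ∩ A j).Nonempty
  have hsymm : ∀ i j, (A i ∩ A j).Nonempty → (A j ∩ A i).Nonempty := fun i j h => by
    rwa [inter_comm]
  have hET : ∀ i j, E i j → ∃ n, j ∈ T i n := by
    intro i j h
    have hmono : ∀ j k, (A j ∩ A k).Nonempty → ((∃ n, j ∈ T i n) ↔ ∃ n, k ∈ T i n) := by
      intro j k hjk
      constructor
      · rintro ⟨n, hn⟩
        exact ⟨n + 1, hTs i n ▸ mem_biUnion hn hjk⟩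
      · rintro ⟨n, hn⟩
        exact ⟨n + 1, hTs i n ▸ mem_biUnion hn (hsymm _ _ hjk)⟩
    have : ∀ a b, E a b → ((∃ n, a ∈ T i n) ↔ ∃ n, b ∈ T i n) := by
      intro a b hab
      induction hab with
      | rel a b hab => exact hmono a b hab
      | refl a => exact Iff.rfl
      | symm a b _ ih => exact ih.symm
      | trans a b c _ _ ih ih' => exact ih.trans ih'
    exact (this i j h).1 ⟨0, hT0 i ▸ rfl⟩
  have hclass : ∀ i, #{j | E i j} ≤ m i := by
    intro i
    have : {j | E i j} ⊆ ⋃ n : ULift.{u} ℕ, T i n.down := fun j hj =>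
      let ⟨n, hn⟩ := hET i j hj
      mem_iUnion.2 ⟨⟨n⟩, hn⟩
    refine (mk_le_mk_of_subset this).trans ((mk_iUnion_le _).trans ?_)
    refine (mul_le_mul' ?_ (ciSup_le' fun n : ULift.{u} ℕ => hTc i n.down)).trans
      (mul_eq_self (hm i)).le
    simpa using hm i
  have key : ∀ q : Quotient E, ∃ f : {j // Quotient.mk E j = q} → S,
      Function.Injective f ∧ ∀ j, f j ∈ A j.1 := by
    intro q
    refine exists_injective_forall_mem_of_mk_le (fun j : {j // Quotient.mk E j = q} => A j) ?_
    rintro ⟨i, rfl⟩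
    refine le_trans ?_ (hA i)
    refine (mk_le_mk_of_subset ?_).trans (hclass i)
    intro j hj
    exact E.symm (Quotient.exact hj)
  choose f hf hfA using key
  refine ⟨fun i => f (Quotient.mk E i) ⟨i, rfl⟩, ?_, fun i => hfA (Quotient.mk E i) ⟨i, rfl⟩⟩
  intro i j hij
  have hE : Quotient.mk E i = Quotient.mk E j := by
    refine Quotient.sound (Relation.EqvGen.rel _ _
      ⟨f (Quotient.mk E i) ⟨i, rfl⟩, hfA (Quotient.mk E i) ⟨i, rfl⟩, ?_⟩)
    rw [show f (Quotient.mk E i) ⟨i, rfl⟩ = f (Quotient.mk E j) ⟨j, rfl⟩ from hij]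
    exact hfA (Quotient.mk E j) ⟨j, rfl⟩
  have hcast : ∀ q (hq : Quotient.mk E i = q),
      f (Quotient.mk E i) ⟨i, rfl⟩ = f q ⟨i, hq⟩ := by
    rintro _ rfl
    rfl
  have h2 : f (Quotient.mk E j) ⟨i, hE⟩ = f (Quotient.mk E j) ⟨j, rfl⟩ :=
    (hcast _ hE).symm.trans hij
  exact congrArg Subtype.val (hf _ h2)

/-- Greedy construction of a partition from a family `C` of admissible sets. -/
theorem exists_partition_of_forall_mk_lt {X : Type u} (C : Set (Set X))
    (h : ∀ x, ∀ F ⊆ C, #F < #X → x ∉ ⋃₀ F → ∃ K ∈ C, x ∈ K ∧ Disjoint K (⋃₀ F)) :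
    ∃ P ⊆ C, P.PairwiseDisjoint id ∧ ⋃₀ P = Set.univ := by
  classical
  obtain ⟨_, _, ho⟩ := exists_ord_eq_type_lt X
  let G : ∀ x, ({y // y < x} → Set X) → Set X := fun x g =>
    if hx : ∃ K ∈ C, x ∈ K ∧ Disjoint K (⋃ y, g y) then hx.choose else ∅
  have hG : ∀ x g, G x g ≠ ∅ → G x g ∈ C ∧ x ∈ G x g ∧ Disjoint (G x g) (⋃ y, g y) := by
    intro x g hne
    by_cases hx : ∃ K ∈ C, x ∈ K ∧ Disjoint K (⋃ y, g y)
    · have : G x g = hx.choose := dif_pos hx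
      rw [this]
      exact hx.choose_spec
    · exact absurd (dif_neg hx) hne
  let f : X → Set X := wellFounded_lt.fix fun x g => G x fun y => g y.1 y.2
  have hf : ∀ x, f x = G x fun y => f y.1 := fun x => wellFounded_lt.fix_eq _ x
  have hdisj : ∀ x y, y < x → Disjoint (f x) (f y) := by
    intro x y hyx
    by_cases hne : f x = ∅
    · rw [hne]; exact empty_disjoint _
    · rw [hf] at hne
      have := (hG _ _ hne).2.2
      rw [← hf] at this
      exact this.mono_right (subset_iUnion (fun y : {y // y < x} => f y.1) ⟨y, hyx⟩)
  refine ⟨{K | K ≠ ∅ ∧ ∃ x, f x = K}, ?_, ?_, ?_⟩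
  · rintro _ ⟨hne, x, rfl⟩
    rw [hf] at hne ⊢
    exact (hG _ _ hne).1
  · rintro _ ⟨-, x, rfl⟩ _ ⟨-, y, rfl⟩ hxy
    rcases lt_trichotomy x y with h | h | h
    · exact (hdisj _ _ h).symm
    · exact absurd (by rw [h]) hxy
    · exact hdisj _ _ h
  · refine eq_univ_of_forall fun x => ?_
    by_cases hx : ∃ y, y < x ∧ x ∈ f y
    · obtain ⟨y, -, hy⟩ := hx
      exact ⟨f y, ⟨Set.Nonempty.ne_empty ⟨x, hy⟩, y, rfl⟩, hy⟩
    · have hx' : ∃ K ∈ C, x ∈ K ∧ Disjoint K (⋃ y : {y // y < x}, f y.1) := by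
        let F : Set (Set X) := {K | K ≠ ∅ ∧ ∃ y : {y // y < x}, f y.1 = K}
        have hF : ⋃₀ F = ⋃ y : {y // y < x}, f y.1 := by
          ext z
          constructor
          · rintro ⟨_, ⟨-, y, rfl⟩, hz⟩
            exact mem_iUnion.2 ⟨y, hz⟩
          · intro hz
            obtain ⟨y, hz⟩ := mem_iUnion.1 hz
            exact ⟨_, ⟨Set.Nonempty.ne_empty ⟨z, hz⟩, y, rfl⟩, hz⟩
        rw [← hF]
        refine h x F ?_ ?_ ?_
        · rintro _ ⟨hne, y, rfl⟩
          rw [hf] at hne ⊢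
          exact (hG _ _ hne).1
        · have : F ⊆ range fun y : {y // y < x} => f y.1 := fun K hK => hK.2
          exact ((mk_le_mk_of_subset this).trans mk_range_le).trans_lt (mk_Iio_lt x ho)
        · rw [hF, mem_iUnion]
          rintro ⟨y, hy⟩
          exact hx ⟨y.1, y.2, hy⟩
      have hfx : f x = hx'.choose := (hf x).trans (dif_pos hx')
      have hmem : x ∈ f x := hfx ▸ hx'.choose_spec.2.1
      exact ⟨f x, ⟨Set.Nonempty.ne_empty ⟨x, hmem⟩, x, rfl⟩, hmem⟩

end Recursion

section CantorPieces

theorem IsCopy.mk_eq_continuum {X : Type u} [TopologicalSpace X] {K : Set X}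
    (h : IsCopy (ℕ → Bool) K) : #K = 𝔠 := by
  obtain ⟨f, hf, rfl⟩ := h
  simpa using mk_range_eq_of_injective hf.injective

theorem isCopy_cylinder (b : ℕ → Bool) (m : ℕ) :
    IsCopy (ℕ → Bool) (PiNat.cylinder b m) := by
  have hr : range (fun (z : ℕ → Bool) n => if n < m then b n else z (n - m)) =
      PiNat.cylinder b m := by
    ext y
    simp only [mem_range, PiNat.mem_cylinder_iff]
    constructor
    · rintro ⟨z, rfl⟩ i hi
      simp [hi]
    · intro h
      refine ⟨fun n => y (n + m), funext fun n => ?_⟩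
      by_cases hn : n < m
      · simp [hn, h n hn]
      · simp [hn, Nat.sub_add_cancel (not_lt.1 hn)]
  rw [← hr]
  refine Continuous.isCopy_range (continuous_pi fun n => ?_) fun z w h => funext fun n => ?_
  · by_cases hn : n < m
    · simp only [hn, if_true]; exact continuous_const
    · simp only [hn, if_false]; exact continuous_apply _
  · simpa using congrFun h (n + m)

theorem isPartitionableSet_compl_cylinder (b : ℕ → Bool) (m : ℕ) :
    IsPartitionableSet (ℕ → Bool) (PiNat.cylinder b m)ᶜ := by
  refine ⟨{K | ∃ y ∉ PiNat.cylinder b m, K = PiNat.cylinder y m}, ?_, ?_, ?_⟩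
  · rintro _ ⟨y, -, rfl⟩
    exact isCopy_cylinder y m
  · rintro _ ⟨y, -, rfl⟩ _ ⟨z, -, rfl⟩ hne
    refine disjoint_left.2 fun w hy hz => hne ?_
    simp only [id, PiNat.mem_cylinder_iff_eq] at hy hz
    rw [← hy, hz]
  · ext z
    simp only [mem_sUnion, mem_ofPred, mem_compl_iff]
    constructor
    · rintro ⟨_, ⟨y, hy, rfl⟩, hz⟩ hzb
      rw [PiNat.mem_cylinder_iff_eq] at hz hzb
      exact hy (PiNat.mem_cylinder_iff_eq.2 (hz.symm.trans hzb))
    · exact fun hz => ⟨_, ⟨z, hz, rfl⟩, PiNat.self_mem_cylinder z m⟩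

theorem exists_cylinder_subset {U : Set (ℕ → Bool)} (hU : IsOpen U) {x : ℕ → Bool} (hx : x ∈ U) :
    ∃ m, PiNat.cylinder x m ⊆ U := by
  obtain ⟨_, ⟨y, m, rfl⟩, hxy, hsub⟩ :=
    (PiNat.isTopologicalBasis_cylinders fun _ : ℕ => Bool).exists_subset_of_mem_open hx hU
  exact ⟨m, PiNat.mem_cylinder_iff_eq.1 hxy ▸ hsub⟩

/-- The Cantor space is homeomorphic to its square. -/
def cantorHomeomorphProd : (ℕ → Bool) ≃ₜ (ℕ → Bool) × (ℕ → Bool) :=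
  (Homeomorph.piCongrLeft (Y := fun _ : ℕ => Bool) Equiv.natSumNatEquivNat).symm.trans
    Homeomorph.sumArrowHomeomorphProdArrow

/-- Given nonempty open subsets `V j` of the Cantor space, there are pairwise disjoint copies
`P (j, a)` of the Cantor space with `P (j, a) ⊆ V j`, such that removing any number of them
leaves a set that can be partitioned into copies of the Cantor space. -/
theorem exists_removable_copies (V : ℕ → Set (ℕ → Bool)) (hV : ∀ j, IsOpen (V j))
    (hne : ∀ j, (V j).Nonempty) :
    ∃ P : ℕ × (ℕ → Bool) → Set (ℕ → Bool), (∀ t, IsCopy (ℕ → Bool) (P t)) ∧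
      (∀ t, P t ⊆ V t.1) ∧ (Pairwise fun s t => Disjoint (P s) (P t)) ∧
      ∀ T : Set (ℕ × (ℕ → Bool)), IsPartitionableSet (ℕ → Bool) (⋃ t ∈ T, P t)ᶜ := by
  let e := cantorHomeomorphProd.symm
  have hbox : ∀ j, ∃ (a b : ℕ → Bool) (m : ℕ),
      ∀ x ∈ PiNat.cylinder a m, ∀ y ∈ PiNat.cylinder b m, e (x, y) ∈ V j := by
    intro j
    obtain ⟨z, hz⟩ := hne j
    obtain ⟨⟨a, b⟩, rfl⟩ := e.surjective z
    obtain ⟨A, B, hA, hB, ha, hb, hAB⟩ :=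
      isOpen_prod_iff.1 ((hV j).preimage e.continuous) a b hz
    obtain ⟨k, hk⟩ := exists_cylinder_subset hA ha
    obtain ⟨l, hl⟩ := exists_cylinder_subset hB hb
    refine ⟨a, b, max k l, fun x hx y hy => hAB ⟨hk ?_, hl ?_⟩⟩
    · exact PiNat.cylinder_anti _ (le_max_left _ _) hx
    · exact PiNat.cylinder_anti _ (le_max_right _ _) hy
  choose a b m hbox using hbox
  obtain ⟨c, hc, hca⟩ := exists_injective_forall_mem_of_mk_le
    (fun t : ℕ × (ℕ → Bool) => PiNat.cylinder (a t.1) (m t.1)) (fun t => by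
      rw [(isCopy_cylinder _ _).mk_eq_continuum]
      simp)
  have hslice : ∀ x, IsEmbedding fun y => e (x, y) := fun x =>
    e.isEmbedding.comp (isEmbedding_prodMkRight x)
  let W : ℕ × (ℕ → Bool) → Set (ℕ → Bool) := fun t => PiNat.cylinder (b t.1) (m t.1)
  refine ⟨fun t => (fun y => e (c t, y)) '' W t, fun t => (isCopy_cylinder _ _).image (hslice _),
    ?_, ?_, ?_⟩
  · rintro t _ ⟨y, hy, rfl⟩
    exact hbox _ _ (hca t) _ hy
  · intro s t hst
    refine disjoint_left.2 ?_
    rintro _ ⟨y, -, rfl⟩ ⟨z, -, hz⟩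
    exact hst (hc (Prod.ext_iff.1 (e.injective hz)).1.symm)
  · intro T
    let G : (ℕ → Bool) → Set (ℕ → Bool) := fun x => {y | ∀ t ∈ T, c t = x → y ∉ W t}
    have hG : (⋃ t ∈ T, (fun y => e (c t, y)) '' W t)ᶜ = ⋃ x, (fun y => e (x, y)) '' G x := by
      ext z
      obtain ⟨⟨x, y⟩, rfl⟩ := e.surjective z
      simp only [mem_compl_iff, mem_iUnion, mem_image, EmbeddingLike.apply_eq_iff_eq,
        Prod.mk.injEq, not_exists, not_and, exists_prop]
      constructor
      · intro h
        refine ⟨x, y, fun t ht htx hy => h t ht y hy htx rfl, rfl, rfl⟩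
      · rintro ⟨x, y, hy, rfl, rfl⟩ t ht y' hy' htx rfl
        exact hy t ht htx hy'
    rw [hG]
    refine IsPartitionableSet.iUnion (fun x => IsPartitionableSet.image ?_ (hslice x)) ?_
    · by_cases hx : ∃ t ∈ T, c t = x
      · obtain ⟨t, ht, rfl⟩ := hx
        have : G (c t) = (W t)ᶜ := by
          ext y
          exact ⟨fun h => h t ht rfl, fun h s _ hst => hc hst ▸ h⟩
        rw [this]
        exact isPartitionableSet_compl_cylinder _ _
      · have : G x = range id := by
          rw [range_id]
          exact eq_univ_of_forall fun y t ht htx => absurd ⟨t, ht, htx⟩ hx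
        rw [this]
        exact IsCopy.isPartitionableSet ⟨id, IsEmbedding.id, rfl⟩
    · intro x x' hxx
      refine disjoint_left.2 ?_
      rintro _ ⟨y, -, rfl⟩ ⟨z, -, hz⟩
      exact hxx (Prod.ext_iff.1 (e.injective hz)).1.symm

/-- The union of a point and a sequence of disjoint copies of the Cantor space converging to it
is a copy of the Cantor space. -/
theorem isCopy_insert_iUnion {X : Type*} [TopologicalSpace X] [T2Space X] (x : X)
    (P : ℕ → Set X) (hP : ∀ n, IsCopy (ℕ → Bool) (P n))
    (hd : Pairwise fun m n => Disjoint (P m) (P n)) (hx : ∀ n, x ∉ P n)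
    (hlim : ∀ U ∈ 𝓝 x, ∀ᶠ n in Filter.atTop, P n ⊆ U) :
    IsCopy (ℕ → Bool) (insert x (⋃ n, P n)) := by
  classical
  choose f hf hfP using hP
  have hmem : ∀ n y, f n y ∈ P n := fun n y => hfP n ▸ mem_range_self y
  let g : (ℕ → Bool) → X := fun z =>
    if h : ∃ n, z n = true then f (Nat.find h) (fun i => z (i + Nat.find h + 1)) else x
  have hg0 : ∀ z, (∀ n, z n = false) → g z = x := fun z hz =>
    dif_neg fun ⟨n, hn⟩ => by simp [hz n] at hn
  have hg1 : ∀ z n, z n = true → (∀ k < n, z k = false) →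
      g z = f n fun i => z (i + n + 1) := by
    intro z n hn hk
    have h : ∃ n, z n = true := ⟨n, hn⟩
    have hfind : Nat.find h = n := (Nat.find_eq_iff h).2 ⟨hn, fun k hkn => by simp [hk k hkn]⟩
    simp only [g, dif_pos h, hfind]
  have hcases : ∀ z : ℕ → Bool, (∀ n, z n = false) ∨
      ∃ n, z n = true ∧ ∀ k < n, z k = false := by
    intro z
    by_cases h : ∃ n, z n = true
    · exact Or.inr ⟨Nat.find h, Nat.find_spec h, fun k hk => by simpa using Nat.find_min h hk⟩
    · exact Or.inl fun n => by simpa using fun hn => h ⟨n, hn⟩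
  have hrange : range g = insert x (⋃ n, P n) := by
    ext y
    simp only [mem_range, mem_insert_iff, mem_iUnion]
    constructor
    · rintro ⟨z, rfl⟩
      rcases hcases z with hz | ⟨n, hn, hk⟩
      · exact Or.inl (hg0 z hz)
      · exact Or.inr ⟨n, hg1 z n hn hk ▸ hmem n _⟩
    · rintro (rfl | ⟨n, hn⟩)
      · exact ⟨fun _ => false, hg0 _ fun _ => rfl⟩
      · rw [← hfP] at hn
        obtain ⟨w, rfl⟩ := hn
        refine ⟨fun i => if i < n then false else if i = n then true else w (i - n - 1), ?_⟩
        rw [hg1 _ n (by simp) (fun k hk => by simp [hk])]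
        congr 1
        funext i
        have h1 : ¬ i + n + 1 < n := by omega
        have h2 : ¬ i + n + 1 = n := by omega
        have h3 : i + n + 1 - n - 1 = i := by omega
        simp only [h1, h2, h3, if_false]
  rw [← hrange]
  refine Continuous.isCopy_range ?_ ?_
  · rw [continuous_iff_continuousAt]
    intro z
    rcases hcases z with hz | ⟨n, hn, hk⟩
    · intro U hU
      rw [hg0 z hz] at hU
      obtain ⟨N, hN⟩ := Filter.eventually_atTop.1 (hlim U hU)
      have hcyl : PiNat.cylinder z N ∈ 𝓝 z :=
        (PiNat.isOpen_cylinder _ z N).mem_nhds (PiNat.self_mem_cylinder z N)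
      refine Filter.mem_map.2 (Filter.mem_of_superset hcyl fun w hw => ?_)
      rw [PiNat.mem_cylinder_iff] at hw
      rcases hcases w with hw0 | ⟨n, hn, hk⟩
      · exact mem_preimage.2 ((hg0 w hw0).symm ▸ mem_of_mem_nhds hU)
      · have hNn : N ≤ n := by
          by_contra! h
          rw [hw n h, hz] at hn
          exact absurd hn (by simp)
        exact hN n hNn (hg1 w n hn hk ▸ hmem n _)
    · have hcyl : PiNat.cylinder z (n + 1) ∈ 𝓝 z :=
        (PiNat.isOpen_cylinder _ z _).mem_nhds (PiNat.self_mem_cylinder z _)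
      have hcont : Continuous fun w : ℕ → Bool => f n fun i => w (i + n + 1) :=
        (hf n).continuous.comp (continuous_pi fun i => continuous_apply _)
      refine hcont.continuousAt.congr (Filter.mem_of_superset hcyl fun w hw => ?_)
      rw [PiNat.mem_cylinder_iff] at hw
      refine (hg1 w n ?_ ?_).symm
      · rw [hw n (by omega), hn]
      · intro k hkn
        rw [hw k (by omega), hk k hkn]
  · intro z w hzw
    rcases hcases z with hz | ⟨n, hn, hk⟩ <;> rcases hcases w with hw | ⟨m, hm, hl⟩
    · funext i
      rw [hz, hw]
    · rw [hg0 z hz, hg1 w m hm hl] at hzw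
      exact absurd (hzw ▸ hmem m _) (hx m)
    · rw [hg0 w hw, hg1 z n hn hk] at hzw
      exact absurd (hzw ▸ hmem n _) (hx n)
    · rw [hg1 w m hm hl, hg1 z n hn hk] at hzw
      have hnm : n = m := by
        by_contra hne
        exact disjoint_left.1 (hd hne) (hmem n _) (hzw ▸ hmem m _)
      subst hnm
      have htail := (hf n).injective hzw
      funext i
      rcases lt_trichotomy i n with h | rfl | h
      · rw [hk i h, hl i h]
      · rw [hn, hm]
      · have := congrFun htail (i - n - 1)
        simpa [show i - n - 1 + n + 1 = i by omega] using this

end CantorPieces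

section Absorption

theorem exists_countable_piBase_cantor : ∃ V : ℕ → Set (ℕ → Bool), (∀ i, IsOpen (V i)) ∧
    (∀ i, (V i).Nonempty) ∧ ∀ U, IsOpen U → U.Nonempty → ∃ i, V i ⊆ U := by
  refine ⟨fun i => PiNat.cylinder (denseSeq _ i.unpair.1) i.unpair.2,
    fun i => PiNat.isOpen_cylinder _ _ _, fun i => ⟨_, PiNat.self_mem_cylinder _ _⟩,
    fun U hU hne => ?_⟩
  obtain ⟨n, hn⟩ := (denseRange_denseSeq (ℕ → Bool)).exists_mem_open hU hne
  obtain ⟨m, hm⟩ := exists_cylinder_subset hU hn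
  exact ⟨Nat.pair n m, by simpa using hm⟩

/-- Let `Q` be a disjoint family of copies of the Cantor space in `X`. If every point outside
`⋃₀ Q` can be assigned a sequence of open pieces of members of `Q` converging to it, in such a
way that each slot is used at most once, then `X` can be partitioned into copies of the Cantor
space. -/
theorem isPartitionableSet_univ_of_injective {X : Type*} [TopologicalSpace X] [T2Space X]
    {Q : Set (Set X)} (hQ : Q.PairwiseDisjoint id) {h : Q → (ℕ → Bool) → X}
    (hh : ∀ L, IsEmbedding (h L)) (hr : ∀ L, range (h L) = L)
    {V : ℕ → Set (ℕ → Bool)} (hVo : ∀ j, IsOpen (V j)) (hVn : ∀ j, (V j).Nonempty)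
    (f : ↥(⋃₀ Q)ᶜ × ℕ → Q × (ℕ × (ℕ → Bool))) (hf : Function.Injective f)
    (hlim : ∀ x : ↥(⋃₀ Q)ᶜ, ∀ N ∈ 𝓝 x.1, ∀ᶠ n in Filter.atTop,
      h (f (x, n)).1 '' V (f (x, n)).2.1 ⊆ N) :
    IsPartitionableSet (ℕ → Bool) (Set.univ : Set X) := by
  obtain ⟨P, hP, hPV, hPd, hPc⟩ := exists_removable_copies V hVo hVn
  have hLd : ∀ L M : Q, L ≠ M → ∀ a b, h L a ≠ h M b := by
    intro L M hne a b hab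
    have h1 : h L a ∈ L.1 := hr L ▸ mem_range_self a
    have h2 : h M b ∈ M.1 := hr M ▸ mem_range_self b
    exact disjoint_left.1 (hQ L.2 M.2 fun h => hne (Subtype.ext h)) h1 (hab ▸ h2)
  have hsub : ∀ L a, h L a ∈ ⋃₀ Q := fun L a => ⟨L.1, L.2, hr L ▸ mem_range_self a⟩
  let p : Q × (ℕ × (ℕ → Bool)) → Set X := fun s => h s.1 '' P s.2
  have hpd : Pairwise fun s t => Disjoint (p s) (p t) := by
    rintro ⟨L, s⟩ ⟨M, t⟩ hne
    refine disjoint_left.2 ?_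
    rintro _ ⟨a, ha, rfl⟩ ⟨b, hb, hab⟩
    rcases eq_or_ne L M with rfl | hLM
    · have hst : s ≠ t := fun h => hne (by rw [h])
      exact disjoint_left.1 (hPd hst) ha ((hh L).injective hab ▸ hb)
    · exact hLd L M hLM a b hab.symm
  have hpQ : ∀ s, p s ⊆ ⋃₀ Q := by
    rintro s _ ⟨a, -, rfl⟩
    exact hsub _ _
  let K : ↥(⋃₀ Q)ᶜ → Set X := fun x => insert x.1 (⋃ n, p (f (x, n)))
  let T : Q → Set (ℕ × (ℕ → Bool)) := fun L => {t | (L, t) ∈ range f}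
  have hK : ∀ x, IsCopy (ℕ → Bool) (K x) := by
    intro x
    refine isCopy_insert_iUnion x.1 _ (fun n => (hP _).image (hh _))
      (fun m n hmn => hpd fun he => hmn (Prod.ext_iff.1 (hf he)).2) (fun n hn => x.2 (hpQ _ hn))
      fun N hN => ?_
    filter_upwards [hlim x N hN] with n hn
    exact (image_mono (hPV _)).trans hn
  have huniv : (Set.univ : Set X) = (⋃ x, K x) ∪ ⋃ L, h L '' (⋃ t ∈ T L, P t)ᶜ := by
    refine (eq_univ_of_forall fun y => ?_).symm
    by_cases hy : y ∈ ⋃₀ Q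
    · obtain ⟨L, hL, hyL⟩ := hy
      rw [← show range (h ⟨L, hL⟩) = L from hr ⟨L, hL⟩] at hyL
      obtain ⟨a, rfl⟩ := hyL
      by_cases ha : a ∈ ⋃ t ∈ T ⟨L, hL⟩, P t
      · obtain ⟨t, ⟨⟨x, n⟩, ht⟩, hat⟩ := mem_iUnion₂.1 ha
        refine Or.inl (mem_iUnion.2 ⟨x, Or.inr (mem_iUnion.2 ⟨n, ?_⟩)⟩)
        rw [ht]
        exact mem_image_of_mem _ hat
      · exact Or.inr (mem_iUnion.2 ⟨_, mem_image_of_mem _ ha⟩)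
    · exact Or.inl (mem_iUnion.2 ⟨⟨y, hy⟩, mem_insert _ _⟩)
  rw [huniv]
  refine IsPartitionableSet.union (IsPartitionableSet.iUnion
    (fun x => (hK x).isPartitionableSet) ?_) (IsPartitionableSet.iUnion
    (fun L => (hPc _).image (hh L)) ?_) ?_
  · intro x y hxy
    refine disjoint_left.2 ?_
    rintro z (rfl | hz) (hz' | hz')
    · exact hxy (Subtype.ext hz')
    · obtain ⟨n, hn⟩ := mem_iUnion.1 hz'
      exact x.2 (hpQ _ hn)
    · obtain ⟨n, hn⟩ := mem_iUnion.1 hz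
      exact y.2 (hz' ▸ hpQ _ hn)
    · obtain ⟨m, hm⟩ := mem_iUnion.1 hz
      obtain ⟨n, hn⟩ := mem_iUnion.1 hz'
      exact disjoint_left.1 (hpd fun he => hxy (Prod.ext_iff.1 (hf he)).1) hm hn
  · intro L M hLM
    refine disjoint_left.2 ?_
    rintro _ ⟨a, -, rfl⟩ ⟨b, -, hab⟩
    exact hLd L M hLM a b hab.symm
  · refine disjoint_left.2 fun z hz hz' => ?_
    obtain ⟨L, a, ha, rfl⟩ := mem_iUnion.1 hz'
    obtain ⟨x, hx | hx⟩ := mem_iUnion.1 hz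
    · exact x.2 (hx ▸ hsub _ _)
    · obtain ⟨n, b, hb, hab⟩ := mem_iUnion.1 hx
      have hL : (f (x, n)).1 = L := by
        by_contra hne
        exact hLd _ _ hne _ _ hab
      subst hL
      exact ha (mem_iUnion₂.2 ⟨_, ⟨(x, n), rfl⟩, (hh _).injective hab ▸ hb⟩)

/-- There is a maximal disjoint family of copies of `Y`. -/
theorem exists_maximal_packing (Y : Type*) [TopologicalSpace Y] [Nonempty Y] (X : Type*)
    [TopologicalSpace X] : ∃ Q : Set (Set X), (∀ L ∈ Q, IsCopy Y L) ∧ Q.PairwiseDisjoint id ∧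
      ∀ K, IsCopy Y K → (K ∩ ⋃₀ Q).Nonempty := by
  obtain ⟨Q, hQ⟩ : ∃ Q, Maximal
      (· ∈ {Q : Set (Set X) | (∀ L ∈ Q, IsCopy Y L) ∧ Q.PairwiseDisjoint id}) Q := by
    refine zorn_subset _ fun c hc hchain => ⟨⋃₀ c, ⟨?_, ?_⟩, fun s hs => subset_sUnion_of_mem hs⟩
    · rintro L ⟨s, hs, hL⟩
      exact (hc hs).1 L hL
    · exact (pairwiseDisjoint_sUnion hchain.directedOn).2 fun s hs => (hc hs).2
  refine ⟨Q, hQ.prop.1, hQ.prop.2, fun K hK => ?_⟩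
  by_contra hne
  rw [not_nonempty_iff_eq_empty, ← disjoint_iff_inter_eq_empty, disjoint_sUnion_right] at hne
  have hins : insert K Q ∈
      {Q : Set (Set X) | (∀ L ∈ Q, IsCopy Y L) ∧ Q.PairwiseDisjoint id} :=
    ⟨forall_mem_insert.2 ⟨hK, hQ.prop.1⟩, hQ.prop.2.insert fun L hL _ => hne L hL⟩
  have hKQ : K ∈ Q := hQ.le_of_ge hins (subset_insert _ _) (mem_insert _ _)
  exact hK.nonempty.ne_empty (disjoint_self.1 (hne K hKQ))

/-- A space of cardinality at most that of the continuum which is first countable and in which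
every nonempty open set contains a Cantor set can be partitioned into Cantor sets. -/
theorem isPartitionableSet_cantor_of_mk_le {X : Type u} [TopologicalSpace X] [T2Space X]
    [FirstCountableTopology X] (hX : #X ≤ 𝔠)
    (hD : ∀ U : Set X, IsOpen U → U.Nonempty → ∃ K ⊆ U, IsCopy (ℕ → Bool) K) :
    IsPartitionableSet (ℕ → Bool) (Set.univ : Set X) := by
  obtain ⟨Q, hQ, hQd, hmax⟩ := exists_maximal_packing (ℕ → Bool) X
  choose h hh hr using fun L : Q => hQ L.1 L.2
  obtain ⟨V, hVo, hVn, hV⟩ := exists_countable_piBase_cantor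
  choose B hB using fun x : X => (𝓝 x).exists_antitone_basis
  have hslot : ∀ i : ↥(⋃₀ Q)ᶜ × ℕ, ∃ (L : Q) (j : ℕ), h L '' V j ⊆ B i.1 i.2 := by
    rintro ⟨x, n⟩
    have hx : x.1 ∈ interior (B x n) := mem_interior_iff_mem_nhds.2 ((hB x).mem n)
    obtain ⟨K, hK, hKc⟩ := hD _ isOpen_interior ⟨_, hx⟩
    obtain ⟨y, hy, L, hL, hyL⟩ := hmax K hKc
    rw [← show range (h ⟨L, hL⟩) = L from hr ⟨L, hL⟩] at hyL
    obtain ⟨a, rfl⟩ := hyL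
    obtain ⟨j, hj⟩ := hV _ (isOpen_interior.preimage (hh ⟨L, hL⟩).continuous) ⟨a, hK hy⟩
    exact ⟨⟨L, hL⟩, j, image_subset_iff.2 (hj.trans (preimage_mono interior_subset))⟩
  choose L j hLj using hslot
  obtain ⟨f, hf, hfA⟩ := exists_injective_forall_mem_of_mk_le
    (fun i => range fun a : ℕ → Bool => (L i, j i, a)) (fun i => by
      have hinj : Function.Injective fun a : ℕ → Bool => (L i, j i, a) := fun a b hab => by
        simpa using hab
      have := mk_range_eq_of_injective hinj
      simp only [lift_id'] at this
      rw [← lift_id'.{0, u} #(range _), this]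
      have h1 : #↥(⋃₀ Q)ᶜ ≤ 𝔠 := (mk_set_le _).trans hX
      have h2 : #(↥(⋃₀ Q)ᶜ × ℕ) ≤ 𝔠 * 𝔠 := by
        rw [mk_prod]
        exact mul_le_mul' (by simpa using h1) (by simpa using aleph0_le_continuum)
      simpa using h2)
  refine isPartitionableSet_univ_of_injective hQd hh hr hVo hVn f hf fun x N hN => ?_
  obtain ⟨n, hn⟩ := (hB x).mem_iff.1 hN
  filter_upwards [Filter.eventually_ge_atTop n] with k hk
  obtain ⟨a, ha⟩ := hfA (x, k)
  rw [← ha]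
  exact (hLj (x, k)).trans (((hB x).antitone hk).trans hn)

end Absorption

section MetricAbsorption

open Metric

theorem continuum_le_mk_mul_continuum {X : Type u} [TopologicalSpace X] {Q : Set (Set X)}
    (hdense : Dense (⋃₀ Q)) {U : Set X} (hU : IsOpen U) (hne : U.Nonempty) :
    𝔠 ≤ #{L : Q | (L.1 ∩ U).Nonempty} * 𝔠 := by
  obtain ⟨y, hy, L, hL, hyL⟩ := hdense.inter_open_nonempty _ hU hne
  have : 1 ≤ #{L : Q | (L.1 ∩ U).Nonempty} := by
    rw [Cardinal.one_le_iff_ne_zero, mk_ne_zero_iff]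
    exact ⟨⟨L, hL⟩, y, hyL, hy⟩
  calc 𝔠 = 1 * 𝔠 := (one_mul _).symm
    _ ≤ _ := mul_le_mul_left this _

/-- Let `Q` be a disjoint family of Cantor sets whose union is dense in the metric space `X`.
If locally there are not more points outside `⋃₀ Q` than there are slots in the members of `Q`,
then `X` can be partitioned into Cantor sets. -/
theorem isPartitionableSet_cantor_of_forall_mk_le {X : Type u} [MetricSpace X] {Q : Set (Set X)}
    (hQ : ∀ L ∈ Q, IsCopy (ℕ → Bool) L) (hQd : Q.PairwiseDisjoint id) (hdense : Dense (⋃₀ Q))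
    (H : ∀ (x : X) (ρ : ℝ), 0 < ρ → #{y : ↥(⋃₀ Q)ᶜ | y.1 ∈ ball x (ρ / 2)} ≤
      #{L : Q | (L.1 ∩ ball x ρ).Nonempty} * 𝔠) :
    IsPartitionableSet (ℕ → Bool) (Set.univ : Set X) := by
  choose h hh hr using fun L : Q => hQ L.1 L.2
  obtain ⟨V, hVo, hVn, hV⟩ := exists_countable_piBase_cantor
  let F : Set X → Set Q := fun U => {L | (L.1 ∩ U).Nonempty}
  let c : Set X → Cardinal.{u} := fun U => #(F U) * 𝔠
  have hc : ∀ U U', U ⊆ U' → c U ≤ c U' := fun U U' hUU => mul_le_mul_left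
    (mk_le_mk_of_subset fun L hL => hL.mono (inter_subset_inter_right _ hUU)) _
  let r : ℕ → ℝ := fun k => (1 / 2) ^ k
  have hrpos : ∀ k, 0 < r k := fun k => by positivity
  let k : X → ℕ := fun x => Function.argmin fun k => c (ball x (r k))
  let M : X → Cardinal.{u} := fun x => c (ball x (r (k x)))
  have hM : ∀ x ρ, 0 < ρ → M x ≤ c (ball x ρ) := by
    intro x ρ hρ
    obtain ⟨l, hl⟩ := exists_pow_lt_of_lt_one hρ (by norm_num : (1 / 2 : ℝ) < 1)
    exact (Function.argmin_le (fun k => c (ball x (r k))) l).trans (hc _ _ (ball_subset_ball hl.le))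
  have hMM : ∀ x y, k x = k y → dist x y < r (k x) / 2 → M x ≤ M y := by
    intro x y hk hd
    refine (hM x _ (half_pos (hrpos (k x)))).trans (hc _ _ fun z hz => ?_)
    rw [← hk]
    rw [mem_ball] at hz ⊢
    linarith [dist_triangle z x y]
  have hMc : ∀ x, 𝔠 ≤ M x := fun x =>
    continuum_le_mk_mul_continuum hdense isOpen_ball ⟨x, mem_ball_self (hrpos (k x))⟩
  let U : ↥(⋃₀ Q)ᶜ × ℕ → Set X := fun i => ball i.1.1 (r (k i.1) / (4 * (i.2 + 1)))
  have hUpos : ∀ i : ↥(⋃₀ Q)ᶜ × ℕ, 0 < r (k i.1) / (4 * (i.2 + 1)) := fun i => by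
    have := hrpos (k i.1)
    positivity
  have hUle : ∀ i : ↥(⋃₀ Q)ᶜ × ℕ, r (k i.1) / (4 * (i.2 + 1)) ≤ r (k i.1) / 4 := fun i => by
    refine div_le_div_of_nonneg_left (hrpos _).le (by norm_num) ?_
    linarith [(Nat.cast_nonneg i.2 : (0 : ℝ) ≤ i.2)]
  let A : ↥(⋃₀ Q)ᶜ × ℕ → Set (Q × (ℕ × (ℕ → Bool))) := fun i =>
    {s | h s.1 '' V s.2.1.unpair.1 ⊆ U i ∧ s.2.1.unpair.2 = k i.1}
  have hA : ∀ i, M i.1 ≤ #(A i) := by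
    intro i
    refine (hM _ _ (hUpos i)).trans ?_
    have hj : ∀ L : F (U i), ∃ j, h L.1 '' V j ⊆ U i := by
      rintro ⟨L, y, hyL, hy⟩
      rw [← hr L] at hyL
      obtain ⟨a, rfl⟩ := hyL
      obtain ⟨j, hj⟩ := hV _ (isOpen_ball.preimage (hh L).continuous) ⟨a, hy⟩
      exact ⟨j, image_subset_iff.2 hj⟩
    choose j hj using hj
    let g : F (U i) × (ℕ → Bool) → A i := fun p =>
      ⟨(p.1.1, Nat.pair (j p.1) (k i.1), p.2), by simpa [A] using hj p.1⟩
    have hg : Function.Injective g := by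
      rintro ⟨L, a⟩ ⟨L', a'⟩ he
      have he' := congrArg Subtype.val he
      simp only [g, Prod.mk.injEq] at he'
      exact Prod.ext (Subtype.ext he'.1) he'.2.2
    have := mk_le_of_injective hg
    rw [mk_prod] at this
    simpa [c] using this
  have hAA : ∀ i j, (A i ∩ A j).Nonempty →
      k i.1 = k j.1 ∧ dist i.1.1 j.1.1 < r (k i.1) / 2 := by
    rintro i j ⟨s, ⟨hs, hsk⟩, hs', hsk'⟩
    have hk : k i.1 = k j.1 := hsk.symm.trans hsk'
    refine ⟨hk, ?_⟩
    obtain ⟨a, ha⟩ := hVn s.2.1.unpair.1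
    have h1 := (mem_ball.1 (hs (mem_image_of_mem _ ha))).trans_le (hUle i)
    have h2 := (mem_ball.1 (hs' (mem_image_of_mem _ ha))).trans_le (hUle j)
    rw [← hk] at h2
    linarith [dist_triangle_left i.1.1 j.1.1 (h s.1 a)]
  have heq : ∀ i j, (A i ∩ A j).Nonempty → M i.1 = M j.1 := fun i j hij => by
    obtain ⟨hk, hd⟩ := hAA i j hij
    exact le_antisymm (hMM _ _ hk hd) (hMM _ _ hk.symm (by rwa [dist_comm, ← hk]))
  have hle : ∀ i, #{j | (A i ∩ A j).Nonempty} ≤ M i.1 := fun i => by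
    have hsub : {j | (A i ∩ A j).Nonempty} ⊆
        {y : ↥(⋃₀ Q)ᶜ | y.1 ∈ ball i.1.1 (r (k i.1) / 2)} ×ˢ (Set.univ : Set ℕ) := fun j hj =>
      ⟨by simpa [dist_comm] using (hAA i j hj).2, mem_univ _⟩
    refine (mk_le_mk_of_subset hsub).trans ?_
    rw [mk_congr (Equiv.Set.prod _ _), mk_prod, lift_uzero, mk_univ, mk_nat, lift_aleph0]
    exact (mul_le_mul' (H _ _ (hrpos _)) (aleph0_le_continuum.trans (hMc i.1))).trans
      (mul_eq_self (aleph0_le_continuum.trans (hMc i.1))).le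
  obtain ⟨f, hf, hfA⟩ := exists_injective_forall_mem_of_mk_inter_le A (fun i => M i.1)
    (fun i => aleph0_le_continuum.trans (hMc _)) hA heq hle
  refine isPartitionableSet_univ_of_injective hQd hh hr (V := fun j => V j.unpair.1)
    (fun j => hVo _) (fun j => hVn _) f hf fun x N hN => ?_
  obtain ⟨ε, hε, hεN⟩ := Metric.mem_nhds_iff.1 hN
  have hlim : Filter.Tendsto (fun n : ℕ => r (k x) / (4 * ((n : ℝ) + 1))) Filter.atTop (𝓝 0) := by
    have := (tendsto_one_div_add_atTop_nhds_zero_nat (𝕜 := ℝ)).const_mul (r (k x) / 4)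
    rw [mul_zero] at this
    refine this.congr fun n => ?_
    field_simp
  filter_upwards [hlim.eventually_lt_const hε] with n hn
  exact (hfA (x, n)).1.trans ((ball_subset_ball hn.le).trans hεN)

end MetricAbsorption

section CardinalArithmetic

theorem succ_power_aleph0_le {κ : Cardinal.{u}} (hκ : ℵ₀ ≤ κ) (h : κ ^ ℵ₀ ≤ κ) :
    Order.succ κ ^ ℵ₀ ≤ Order.succ κ := by
  obtain ⟨α, hα⟩ : ∃ α : Type u, #α = Order.succ κ := ⟨_, mk_out _⟩
  obtain ⟨_, _, ho⟩ := exists_ord_eq_type_lt α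
  have hIio : ∀ x : α, #(Iio x) ≤ κ := fun x => by
    have := mk_Iio_lt x ho
    rwa [hα, Order.lt_succ_iff] at this
  have hbdd : ∀ f : ULift.{u} ℕ → α, ∃ x, ∀ n, f n < x := by
    intro f
    by_contra! hf
    have hsub : (Set.univ : Set α) ⊆ ⋃ n, insert (f n) (Iio (f n)) := fun x _ => by
      obtain ⟨n, hn⟩ := hf x
      exact mem_iUnion.2 ⟨n, hn.eq_or_lt⟩
    have h1 : Order.succ κ ≤ κ := by
      rw [← hα, ← mk_univ]
      refine (mk_le_mk_of_subset hsub).trans ((mk_iUnion_le _).trans ?_)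
      refine (mul_le_mul' (b := κ) (by simpa using hκ) (ciSup_le' fun n => ?_)).trans
        (mul_eq_self hκ).le
      exact (mk_insert_le.trans (add_le_add_left (hIio _) 1)).trans
        (add_one_eq hκ).le
    exact absurd h1 (Order.lt_succ κ).not_ge
  choose b hb using hbdd
  have hinj : Function.Injective fun f : ULift.{u} ℕ → α =>
      (⟨b f, fun n => ⟨f n, hb f n⟩⟩ : Σ x : α, (ULift.{u} ℕ → Iio x)) := by
    intro f g hfg
    have h2 : ∀ s t : Σ x : α, (ULift.{u} ℕ → Iio x), s = t → ∀ n, (s.2 n).1 = (t.2 n).1 := by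
      rintro s _ rfl n
      rfl
    exact funext (h2 _ _ hfg)
  have := mk_le_of_injective hinj
  rw [mk_sigma] at this
  have hle : Cardinal.sum (fun x : α => #(ULift.{u} ℕ → Iio x)) ≤ Order.succ κ := by
    refine (sum_le_mk_mul_iSup _).trans ?_
    rw [hα]
    refine (mul_le_mul' le_rfl (ciSup_le' fun x => ?_)).trans
      (mul_eq_self (hκ.trans (Order.le_succ κ))).le
    have h3 := (power_le_power_right (c := ℵ₀) (hIio x)).trans (h.trans (Order.le_succ κ))
    simpa [← power_def] using h3
  have h4 := this.trans hle
  rw [← power_def, hα] at h4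
  simpa using h4

theorem power_aleph0_le_of_le_succ_iterate (n : ℕ) {κ : Cardinal.{u}} (h𝔠 : 𝔠 ≤ κ)
    (hκ : κ ≤ Order.succ^[n] 𝔠) : κ ^ ℵ₀ ≤ κ := by
  induction n generalizing κ with
  | zero =>
    rw [le_antisymm hκ h𝔠]
    exact continuum_power_aleph0.le
  | succ n ih =>
    rw [Function.iterate_succ_apply'] at hκ
    rcases hκ.lt_or_eq with h | rfl
    · exact ih h𝔠 (Order.lt_succ_iff.1 h)
    · have hc : ∀ n, 𝔠 ≤ Order.succ^[n] 𝔠 := fun n => Order.le_succ_iterate n _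
      exact succ_power_aleph0_le (aleph0_le_continuum.trans (hc n)) (ih (hc n) le_rfl)

theorem mk_closure_le_power_aleph0 {X : Type u} [TopologicalSpace X] [T2Space X]
    [FrechetUrysohnSpace X] (D : Set X) : #(closure D) ≤ #D ^ ℵ₀ := by
  have : ∀ x : closure D, ∃ f : ℕ → D, Filter.Tendsto (fun n => (f n : X)) Filter.atTop (𝓝 x) := by
    rintro ⟨x, hx⟩
    obtain ⟨f, hf, hlim⟩ := mem_closure_iff_seq_limit.1 hx
    exact ⟨fun n => ⟨f n, hf n⟩, hlim⟩
  choose f hf using this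
  have hinj : Function.Injective f := fun x y hxy =>
    Subtype.ext (tendsto_nhds_unique (hf x) (hxy ▸ hf y))
  simpa using mk_le_of_injective hinj

end CardinalArithmetic

section MetricCase

theorem mk_setOf_compl_le {X : Type u} (Q : Set (Set X)) {U W : Set X} (hUW : U ⊆ W) :
    #{y : ↥(⋃₀ Q)ᶜ | y.1 ∈ U} ≤ #W :=
  mk_le_of_injective (f := fun y => ⟨y.1.1, hUW y.2⟩) fun y z hyz => by
    simpa [Subtype.ext_iff] using hyz

open Metric

variable {X : Type u} [MetricSpace X]

theorem mk_iUnion_inter_ball_le {Q : Set (Set X)} (hQ : ∀ L ∈ Q, IsCopy (ℕ → Bool) L) (U : Set X) :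
    #↥(⋃ L ∈ {L : Q | (L.1 ∩ U).Nonempty}, L.1) ≤ #{L : Q | (L.1 ∩ U).Nonempty} * 𝔠 := by
  refine (mk_biUnion_le _ _).trans (mul_le_mul' le_rfl (ciSup_le' fun L => ?_))
  exact (hQ _ L.1.2).mk_eq_continuum.le

theorem subset_closure_iUnion {Q : Set (Set X)} (hdense : Dense (⋃₀ Q)) {U : Set X}
    (hU : IsOpen U) : U ⊆ closure (⋃ L ∈ {L : Q | (L.1 ∩ U).Nonempty}, L.1) := by
  refine (hdense.open_subset_closure_inter hU).trans (closure_mono ?_)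
  rintro y ⟨hy, L, hL, hyL⟩
  exact mem_iUnion₂.2 ⟨⟨L, hL⟩, ⟨y, hyL, hy⟩, hyL⟩

theorem dense_sUnion_of_maximal {Q : Set (Set X)}
    (hmax : ∀ K, IsCopy (ℕ → Bool) K → (K ∩ ⋃₀ Q).Nonempty)
    (hD : ∀ U : Set X, IsOpen U → U.Nonempty → ∃ K ⊆ U, IsCopy (ℕ → Bool) K) :
    Dense (⋃₀ Q) := by
  refine dense_iff_inter_open.2 fun U hU hne => ?_
  obtain ⟨K, hK, hKc⟩ := hD U hU hne
  exact (hmax K hKc).mono (inter_subset_inter_left _ hK)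

theorem isPartitionableSet_cantor_of_mk_le_contSuccOmega (hX : #X ≤ contSuccOmega)
    (hD : ∀ U : Set X, IsOpen U → U.Nonempty → ∃ K ⊆ U, IsCopy (ℕ → Bool) K) :
    IsPartitionableSet (ℕ → Bool) (Set.univ : Set X) := by
  obtain ⟨Q, hQ, hQd, hmax⟩ := exists_maximal_packing (ℕ → Bool) X
  have hdense := dense_sUnion_of_maximal hmax hD
  refine isPartitionableSet_cantor_of_forall_mk_le hQ hQd hdense fun x ρ hρ => ?_
  set κ := #{L : Q | (L.1 ∩ ball x ρ).Nonempty} * 𝔠 with hκ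
  have hκc : 𝔠 ≤ κ := continuum_le_mk_mul_continuum hdense isOpen_ball ⟨x, mem_ball_self hρ⟩
  rcases le_or_gt contSuccOmega κ with h | h
  · exact (mk_setOf_compl_le Q (subset_univ _)).trans (mk_univ.le.trans (hX.trans h))
  · obtain ⟨n, hn⟩ := exists_lt_of_lt_ciSup h
    refine (mk_setOf_compl_le Q ((ball_subset_ball (half_le_self hρ.le)).trans
      (subset_closure_iUnion hdense isOpen_ball))).trans ?_
    refine (mk_closure_le_power_aleph0 _).trans ?_
    exact (power_le_power_right (mk_iUnion_inter_ball_le hQ _)).trans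
      (power_aleph0_le_of_le_succ_iterate n hκc hn.le)

end MetricCase

section CompleteTrees

open Metric

variable {Z : Type u} [MetricSpace Z]

theorem exists_separated_subsets_dense (V : Set Z) : ∃ A : ℕ → Set Z, (∀ n, A n ⊆ V) ∧
    (∀ n : ℕ, (A n).Pairwise fun x y => 1 / ((n : ℝ) + 1) ≤ dist x y) ∧
    V ⊆ closure (⋃ n, A n) := by
  have hmax : ∀ ε : ℝ, ∃ A, Maximal
      (· ∈ {A : Set Z | A ⊆ V ∧ A.Pairwise fun x y => ε ≤ dist x y}) A := by
    intro ε
    refine zorn_subset _ fun c hc hchain => ⟨⋃₀ c, ⟨sUnion_subset fun s hs => (hc hs).1, ?_⟩,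
      fun s hs => subset_sUnion_of_mem hs⟩
    exact (pairwise_sUnion hchain.directedOn).2 fun s hs => (hc hs).2
  choose A hA using fun n : ℕ => hmax (1 / ((n : ℝ) + 1))
  refine ⟨A, fun n => (hA n).prop.1, fun n => (hA n).prop.2, fun x hx => ?_⟩
  refine Metric.mem_closure_iff.2 fun ε hε => ?_
  obtain ⟨n, hn⟩ := exists_nat_one_div_lt hε
  by_contra! hfar
  have hfar' : ∀ y ∈ A n, ε ≤ dist x y := fun y hy => hfar y (mem_iUnion.2 ⟨n, hy⟩)
  have hins : insert x (A n) ∈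
      {A : Set Z | A ⊆ V ∧ A.Pairwise fun x y => 1 / ((n : ℝ) + 1) ≤ dist x y} := by
    refine ⟨insert_subset hx (hA n).prop.1, (hA n).prop.2.insert fun y hy _ => ?_⟩
    exact ⟨hn.le.trans (hfar' y hy), hn.le.trans (dist_comm x y ▸ hfar' y hy)⟩
  have hxA : x ∈ A n := (hA n).le_of_ge hins (subset_insert _ _) (mem_insert _ _)
  exact absurd (hfar' x hxA) (by rw [dist_self]; exact not_le.2 hε)

theorem exists_disjoint_open_of_separated {V A : Set Z} (hV : IsOpen V) (hAV : A ⊆ V) {ε : ℝ}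
    (hε : 0 < ε) (hA : A.Pairwise fun x y => ε ≤ dist x y) :
    ∃ B : A → Set Z, (∀ i, IsOpen (B i)) ∧ (∀ i, (B i).Nonempty) ∧ (∀ i, B i ⊆ V) ∧
      Pairwise fun i j => Disjoint (B i) (B j) := by
  refine ⟨fun x => ball x.1 (ε / 2) ∩ V, fun x => isOpen_ball.inter hV,
    fun x => ⟨x.1, mem_ball_self (half_pos hε), hAV x.2⟩, fun x => inter_subset_right, ?_⟩
  intro x y hxy
  refine ((ball_disjoint_ball ?_).mono_left inter_subset_left).mono_right inter_subset_left
  rw [add_halves]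
  exact hA x.2 y.2 fun h => hxy (Subtype.ext h)

/-- If every nonempty open set has density at least `μ`, where `μ` is uncountable, then every
nonempty open set contains `μ` many disjoint nonempty open sets. -/
theorem exists_disjoint_open_of_density {μ : Cardinal.{u}} (hμ : ℵ₀ < μ)
    (hdens : ∀ U : Set Z, IsOpen U → U.Nonempty → ∀ S, U ⊆ closure S → μ ≤ #S)
    {V : Set Z} (hV : IsOpen V) (hne : V.Nonempty) :
    ∃ (J : Type u) (B : J → Set Z), μ ≤ #J ∧ (∀ i, IsOpen (B i)) ∧ (∀ i, (B i).Nonempty) ∧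
      (∀ i, B i ⊆ V) ∧ Pairwise fun i j => Disjoint (B i) (B j) := by
  obtain ⟨A, hAV, hAs, hAd⟩ := exists_separated_subsets_dense V
  by_cases hbig : ∃ n, μ ≤ #(A n)
  · obtain ⟨n, hn⟩ := hbig
    obtain ⟨B, hB⟩ := exists_disjoint_open_of_separated hV (hAV n) (by positivity) (hAs n)
    exact ⟨A n, B, hn, hB⟩
  push Not at hbig
  have hinf : Infinite V := by
    rw [← aleph0_le_mk_iff]
    exact hμ.le.trans (hdens V hV hne V subset_closure)
  obtain ⟨W', hW'inf, hW'o, hW'd⟩ := exists_seq_infinite_isOpen_pairwise_disjoint V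
  let W : ℕ → Set Z := fun n => Subtype.val '' W' n
  have hWo : ∀ n, IsOpen (W n) := fun n => hV.isOpenMap_subtype_val _ (hW'o n)
  have hWV : ∀ n, W n ⊆ V := by
    rintro n _ ⟨x, -, rfl⟩
    exact x.2
  have hWd : Pairwise fun m n => Disjoint (W m) (W n) := fun m n hmn =>
    (disjoint_image_iff Subtype.val_injective).2 (hW'd hmn)
  have hfam : ∀ n, ∃ B : A n → Set Z, (∀ i, IsOpen (B i)) ∧ (∀ i, (B i).Nonempty) ∧
      (∀ i, B i ⊆ W n) ∧ Pairwise fun i j => Disjoint (B i) (B j) := by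
    intro n
    obtain ⟨A', hAV', hAs', hAd'⟩ := exists_separated_subsets_dense (W n)
    obtain ⟨k, hk⟩ : ∃ k, #(A n) ≤ #(A' k) := by
      by_contra! hlt
      have h1 := hdens (W n) (hWo n) ((hW'inf n).nonempty.image _) _ hAd'
      have hsub : (⋃ k, A' k) ⊆ ⋃ k : ULift.{u} ℕ, A' k.down := fun x hx => by
        obtain ⟨k, hk⟩ := mem_iUnion.1 hx
        exact mem_iUnion.2 ⟨⟨k⟩, hk⟩
      have h2 : #↥(⋃ k, A' k) ≤ ℵ₀ * #(A n) := by
        refine (mk_le_mk_of_subset hsub).trans ((mk_iUnion_le _).trans ?_)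
        exact mul_le_mul' (by simp) (ciSup_le' fun k => (hlt _).le)
      exact absurd (h1.trans h2) (mul_lt_of_lt hμ.le hμ (hbig n)).not_ge
    obtain ⟨B, hBo, hBn, hBW, hBd⟩ :=
      exists_disjoint_open_of_separated (hWo n) (hAV' k) (by positivity) (hAs' k)
    obtain ⟨e⟩ := hk
    exact ⟨fun i => B (e i), fun i => hBo _, fun i => hBn _, fun i => hBW _,
      fun i j hij => hBd fun h => hij (e.injective h)⟩
  choose B hBo hBn hBW hBd using hfam
  refine ⟨Σ n : ULift.{u} ℕ, A n.down, fun p => B p.1.down p.2, ?_, fun p => hBo _ _,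
    fun p => hBn _ _, fun p => (hBW _ _).trans (hWV _), ?_⟩
  · refine (hdens V hV hne _ hAd).trans ?_
    refine mk_le_of_surjective (f := fun p => ⟨p.2.1, mem_iUnion.2 ⟨p.1.down, p.2.2⟩⟩) ?_
    rintro ⟨x, hx⟩
    obtain ⟨n, hn⟩ := mem_iUnion.1 hx
    exact ⟨⟨⟨n⟩, x, hn⟩, rfl⟩
  · rintro ⟨⟨m⟩, i⟩ ⟨⟨n⟩, j⟩ hij
    rcases eq_or_ne m n with rfl | hmn
    · refine hBd m fun h => hij ?_
      dsimp only at h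
      rw [h]
    · exact ((hWd hmn).mono_left (hBW _ _)).mono_right (hBW _ _)

/-- If every nonempty open subset of a nonempty complete metric space contains `ι` many disjoint
nonempty open sets, then the space contains an injective continuous image of `ι ^ ℕ`. -/
theorem exists_continuous_injective_of_disjoint_open [CompleteSpace Z] [Nonempty Z] {ι : Type u}
    [TopologicalSpace ι] [DiscreteTopology ι]
    (h : ∀ V : Set Z, IsOpen V → V.Nonempty → ∃ B : ι → Set Z, (∀ i, IsOpen (B i)) ∧
      (∀ i, (B i).Nonempty) ∧ (∀ i, B i ⊆ V) ∧ Pairwise fun i j => Disjoint (B i) (B j)) :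
    ∃ g : (ℕ → ι) → Z, Continuous g ∧ Function.Injective g := by
  let O := {V : Set Z // IsOpen V ∧ V.Nonempty}
  have hstep : ∀ (V : O) (n : ℕ), ∃ B : ι → O, (∀ i, closure (B i).1 ⊆ V.1) ∧
      (∀ i, ediam (B i).1 ≤ 2 * ENNReal.ofReal ((1 / 2) ^ n)) ∧
      Pairwise fun i j => Disjoint (B i).1 (B j).1 := by
    rintro ⟨V, hV, hne⟩ n
    obtain ⟨B, hBo, hBn, hBV, hBd⟩ := h V hV hne
    choose x hx using hBn
    have hball : ∀ i, ∃ ε > 0, closedBall (x i) ε ⊆ B i := fun i =>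
      Metric.nhds_basis_closedBall.mem_iff.1 ((hBo i).mem_nhds (hx i))
    choose ε hε hεB using hball
    have hpos : ∀ i, 0 < min (ε i) ((1 / 2) ^ n) := fun i => lt_min (hε i) (by positivity)
    refine ⟨fun i => ⟨ball (x i) (min (ε i) ((1 / 2) ^ n)), isOpen_ball,
      nonempty_ball.2 (hpos i)⟩, fun i => ?_, fun i => ?_, fun i j hij => ?_⟩
    · exact closure_ball_subset_closedBall.trans
        ((closedBall_subset_closedBall (min_le_left _ _)).trans ((hεB i).trans (hBV i)))
    · dsimp only
      rw [← eball_ofReal]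
      exact ediam_eball_le.trans
        (mul_le_mul_right (ENNReal.ofReal_le_ofReal (min_le_right _ _)) _)
    · have : ∀ i, ball (x i) (min (ε i) ((1 / 2) ^ n)) ⊆ B i := fun i =>
        (ball_subset_ball (min_le_left _ _)).trans (ball_subset_closedBall.trans (hεB i))
      exact ((hBd hij).mono_left (this i)).mono_right (this j)
  choose S hSc hSd hSD using hstep
  let A : List ι → O := fun l =>
    List.rec ⟨Set.univ, isOpen_univ, univ_nonempty⟩ (fun a l V => S V l.length a) l
  have hanti : CantorScheme.ClosureAntitone fun l => (A l).1 := fun l a => hSc _ _ _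
  have hdisj : CantorScheme.Disjoint fun l => (A l).1 := fun l => hSD _ _
  have hdiam : CantorScheme.VanishingDiam fun l => (A l).1 := by
    intro x
    rw [← Filter.tendsto_add_atTop_iff_nat 1]
    have hlim : Filter.Tendsto (fun n : ℕ => 2 * ENNReal.ofReal ((1 / 2) ^ n)) Filter.atTop
        (𝓝 0) := by
      have h1 := (tendsto_pow_atTop_nhds_zero_of_lt_one (r := (1 / 2 : ℝ)) (by norm_num)
        (by norm_num))
      have h2 := ENNReal.Tendsto.const_mul (a := 2) (ENNReal.tendsto_ofReal h1)
        (Or.inr (by norm_num))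
      simpa using h2
    refine tendsto_of_tendsto_of_tendsto_of_le_of_le tendsto_const_nhds hlim
      (fun _ => zero_le) fun n => ?_
    have := hSd (A (PiNat.res x n)) (PiNat.res x n).length (x n)
    rw [PiNat.res_length] at this
    simpa only [PiNat.res_succ, A, PiNat.res_length] using this
  have huniv := hanti.map_of_vanishingDiam hdiam fun l => (A l).2.2
  let g : (ℕ → ι) → Z := fun x => (CantorScheme.inducedMap fun l => (A l).1).2
    ⟨x, huniv ▸ mem_univ x⟩
  refine ⟨g, hdiam.map_continuous.comp (continuous_id.subtype_mk _), fun x y hxy => ?_⟩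
  exact congrArg Subtype.val (hdisj.map_injective hxy)

/-- If all nonempty open subsets of a nonempty complete metric space have more than `κ ≥ 𝔠`
points, then the space contains more than `κ` disjoint Cantor sets. -/
theorem exists_disjoint_cantor_of_lt_mk [CompleteSpace Z] [Nonempty Z] {κ : Cardinal.{u}}
    (hκ : 𝔠 ≤ κ) (h : ∀ U : Set Z, IsOpen U → U.Nonempty → κ < #U) :
    ∃ (J : Type u) (K : J → Set Z), κ < #J ∧ (∀ j, IsCopy (ℕ → Bool) (K j)) ∧
      Pairwise fun i j => Disjoint (K i) (K j) := by
  let D : Set Cardinal.{u} := {c | ∃ U S : Set Z, IsOpen U ∧ U.Nonempty ∧ U ⊆ closure S ∧ #S = c}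
  have hD : D.Nonempty :=
    ⟨_, Set.univ, Set.univ, isOpen_univ, univ_nonempty, subset_closure, rfl⟩
  obtain ⟨U₀, S₀, hU₀, hU₀n, hUS, hS₀⟩ := csInf_mem hD
  set μ := sInf D with hμdef
  have hdens : ∀ U : Set Z, IsOpen U → U.Nonempty → ∀ S, U ⊆ closure S → μ ≤ #S :=
    fun U hU hne S hS => csInf_le' ⟨U, S, hU, hne, hS, rfl⟩
  have hpow : κ < μ ^ ℵ₀ := by
    refine (h U₀ hU₀ hU₀n).trans_le ((mk_le_mk_of_subset hUS).trans ?_)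
    exact (mk_closure_le_power_aleph0 S₀).trans_eq (by rw [hS₀])
  have hμ : 𝔠 < μ := by
    by_contra! hle
    have := (power_le_power_right (c := ℵ₀) hle).trans_eq continuum_power_aleph0
    exact absurd (hpow.trans_le this) hκ.not_gt
  obtain ⟨ι, hι⟩ : ∃ ι : Type u, #ι = μ := ⟨_, mk_out _⟩
  let _ : TopologicalSpace ι := ⊥
  have _ : DiscreteTopology ι := ⟨rfl⟩
  obtain ⟨g, hg, hgi⟩ := exists_continuous_injective_of_disjoint_open (Z := Z) (ι := ι)
    fun V hV hne => by
      obtain ⟨J, B, hJ, hBo, hBn, hBV, hBd⟩ :=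
        exists_disjoint_open_of_density (aleph0_le_continuum.trans_lt hμ) hdens hV hne
      rw [← hι] at hJ
      obtain ⟨e⟩ := hJ
      exact ⟨fun i => B (e i), fun i => hBo _, fun i => hBn _, fun i => hBV _,
        fun i j hij => hBd fun h => hij (e.injective h)⟩
  obtain ⟨e⟩ : Nonempty (ι × Bool ≃ ι) := by
    have : #(ι × ULift.{u} Bool) = #ι := by
      have h0 : ℵ₀ ≤ #ι := hι ▸ (aleph0_le_continuum.trans hμ.le)
      rw [mk_prod]
      simpa using mul_eq_left h0 (ofNat_lt_aleph0.le.trans h0) two_ne_zero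
    obtain ⟨e⟩ := Cardinal.eq.1 this
    exact ⟨(Equiv.prodCongr (Equiv.refl _) Equiv.ulift.symm).trans e⟩
  refine ⟨ULift.{u} ℕ → ι, fun s => range fun b : ℕ → Bool => g fun n => e (s ⟨n⟩, b n), ?_,
    fun s => ?_, fun s t hst => ?_⟩
  · rw [← power_def, hι]
    simpa using hpow
  · refine Continuous.isCopy_range (hg.comp (continuous_pi fun n => ?_)) fun b c hbc => ?_
    · exact (continuous_of_discreteTopology (f := fun i : Bool => e (s ⟨n⟩, i))).comp
        (continuous_apply n)
    · funext n
      simpa using congrFun (hgi hbc) n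
  · refine disjoint_left.2 ?_
    rintro _ ⟨b, rfl⟩ ⟨c, hbc⟩
    refine hst (funext fun ⟨n⟩ => ?_)
    have := congrFun (hgi hbc) n
    simp only [EmbeddingLike.apply_eq_iff_eq, Prod.mk.injEq] at this
    exact this.1.symm

end CompleteTrees

section CompleteCase

open Metric

variable {X : Type u} [MetricSpace X]

/-- If `E` lies in the closure of a set of size at most `κ`, then the points of `E` with a
neighborhood containing at most `κ` points of `E` form a set of size at most `κ`. -/
theorem mk_diff_setOf_lt_mk_inter_ball_le {κ : Cardinal.{u}} (hκ : ℵ₀ ≤ κ) {D E : Set X}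
    (hD : #D ≤ κ) (hE : E ⊆ closure D) :
    #↥(E \ {z | ∀ ε > 0, κ < #↥(E ∩ ball z ε)}) ≤ κ := by
  let r : ULift.{u} ℕ → ℝ := fun n => 1 / ((n.down : ℝ) + 1)
  let I : Set (D × ULift.{u} ℕ) := {p | #↥(E ∩ ball p.1.1 (r p.2)) ≤ κ}
  have hsub : E \ {z | ∀ ε > 0, κ < #↥(E ∩ ball z ε)} ⊆ ⋃ p ∈ I, E ∩ ball p.1.1 (r p.2) := by
    rintro y ⟨hy, hyZ⟩
    simp only [mem_ofPred, not_forall, not_lt] at hyZ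
    obtain ⟨ε, hε, hle⟩ := hyZ
    obtain ⟨n, hn⟩ := exists_nat_one_div_lt (half_pos hε)
    obtain ⟨d, hd, hyd⟩ := Metric.mem_closure_iff.1 (hE hy) (1 / ((n : ℝ) + 1)) (by positivity)
    refine mem_iUnion₂.2 ⟨(⟨d, hd⟩, ⟨n⟩), ?_, hy, hyd⟩
    refine (mk_le_mk_of_subset (inter_subset_inter_right _ ?_)).trans hle
    refine ball_subset_ball' ?_
    rw [dist_comm]
    have : r ⟨n⟩ < ε / 2 := hn
    linarith
  refine (mk_le_mk_of_subset hsub).trans ((mk_biUnion_le _ _).trans ?_)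
  refine (mul_le_mul' ((mk_set_le I).trans ?_) (ciSup_le' fun p => p.2)).trans (mul_eq_self hκ).le
  rw [mk_prod, lift_id, lift_id]
  exact (mul_le_mul' hD (by simpa using hκ)).trans (mul_eq_self hκ).le

theorem isClosed_setOf_lt_mk_inter_ball (κ : Cardinal.{u}) (E : Set X) :
    IsClosed {z | ∀ ε > 0, κ < #↥(E ∩ ball z ε)} := by
  refine isClosed_of_closure_subset fun z hz ε hε => ?_
  obtain ⟨y, hy, hzy⟩ := Metric.mem_closure_iff.1 hz _ (half_pos hε)
  refine (hy _ (half_pos hε)).trans_le (mk_le_mk_of_subset (inter_subset_inter_right _ ?_))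
  refine ball_subset_ball' ?_
  rw [dist_comm]
  linarith

theorem isPartitionableSet_cantor_of_completeSpace [CompleteSpace X]
    (hD : ∀ U : Set X, IsOpen U → U.Nonempty → ∃ K ⊆ U, IsCopy (ℕ → Bool) K) :
    IsPartitionableSet (ℕ → Bool) (Set.univ : Set X) := by
  obtain ⟨Q, hQ, hQd, hmax⟩ := exists_maximal_packing (ℕ → Bool) X
  have hdense := dense_sUnion_of_maximal hmax hD
  refine isPartitionableSet_cantor_of_forall_mk_le hQ hQd hdense fun x ρ hρ => ?_
  refine (mk_setOf_compl_le Q subset_rfl).trans ?_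
  set κ := #{L : Q | (L.1 ∩ ball x ρ).Nonempty} * 𝔠 with hκ
  have hκc : 𝔠 ≤ κ := continuum_le_mk_mul_continuum hdense isOpen_ball ⟨x, mem_ball_self hρ⟩
  have hκω : ℵ₀ ≤ κ := aleph0_le_continuum.trans hκc
  by_contra! hlt
  set E := ball x (ρ / 2)
  set D : Set X := ⋃ L ∈ {L : Q | (L.1 ∩ ball x ρ).Nonempty}, L.1 with hDdef
  have hDκ : #D ≤ κ := mk_iUnion_inter_ball_le hQ _
  have hED : E ⊆ closure D :=
    (ball_subset_ball (half_le_self hρ.le)).trans (subset_closure_iUnion hdense isOpen_ball)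
  let Z : Set X := {z | ∀ ε > 0, κ < #↥(E ∩ ball z ε)}
  have hEZ : #↥(E \ Z) ≤ κ := mk_diff_setOf_lt_mk_inter_ball_le hκω hDκ hED
  have hZ : IsClosed Z := isClosed_setOf_lt_mk_inter_ball κ E
  have hZball : Z ⊆ ball x ρ := by
    intro z hz
    obtain ⟨⟨y, hy, hyz⟩⟩ := mk_ne_zero_iff.1 (hz (ρ / 2) (half_pos hρ)).ne_bot
    rw [mem_ball] at hy hyz ⊢
    linarith [dist_triangle_left z x y]
  have hbig : ∀ A B : Set X, κ < #A → A ⊆ (E \ Z) ∪ B → κ < #B := by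
    intro A B hA hAB
    by_contra! hB
    refine absurd (hA.trans_le ((mk_le_mk_of_subset hAB).trans (mk_union_le _ _))) (not_lt.2 ?_)
    exact (add_le_add hEZ hB).trans (add_eq_self hκω).le
  have hZne : Nonempty Z := by
    have := hbig E Z hlt fun y hy => by
      by_cases h : y ∈ Z
      · exact Or.inr h
      · exact Or.inl ⟨hy, h⟩
    exact mk_ne_zero_iff.1 this.ne_bot
  have _ : CompleteSpace Z := hZ.completeSpace_coe
  obtain ⟨J, K, hJ, hK, hKd⟩ := exists_disjoint_cantor_of_lt_mk (Z := Z) hκc fun U hU hne => by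
    obtain ⟨z, hz⟩ := hne
    obtain ⟨ε, hε, hεU⟩ := Metric.isOpen_iff.1 hU z hz
    have := hbig _ (Subtype.val '' U) (z.2 ε hε) fun y hy => by
      by_cases h : y ∈ Z
      · exact Or.inr ⟨⟨y, h⟩, hεU hy.2, rfl⟩
      · exact Or.inl ⟨hy.1, h⟩
    rwa [mk_image_eq Subtype.val_injective] at this
  have hpt : ∀ j, ∃ y ∈ K j, y.1 ∈ D := by
    intro j
    obtain ⟨_, ⟨y, hy, rfl⟩, L, hL, hyL⟩ := hmax _ ((hK j).image IsEmbedding.subtypeVal)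
    exact ⟨y, hy, mem_iUnion₂.2 ⟨⟨L, hL⟩, ⟨y.1, hyL, hZball y.2⟩, hyL⟩⟩
  choose y hyK hyD using hpt
  have hinj : Function.Injective fun j => (⟨(y j).1, hyD j⟩ : D) := by
    intro i j hij
    by_contra hne
    have h1 : y i = y j := Subtype.ext (Subtype.mk.inj hij)
    exact disjoint_left.1 (hKd hne) (hyK i) (h1 ▸ hyK j)
  exact absurd (hJ.trans_le ((mk_le_of_injective hinj).trans hDκ)) (lt_irrefl _)

end CompleteCase

section ZeroDimensional

/-- A second countable zero-dimensional space embeds into the Cantor group. -/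
theorem exists_isEmbedding_cantor {Y : Type*} [TopologicalSpace Y] [T0Space Y]
    [SecondCountableTopology Y] (hzd : IsTopologicalBasis {s : Set Y | IsClopen s}) :
    ∃ ψ : Y → (ℕ → ZMod 2), IsEmbedding ψ := by
  classical
  obtain ⟨b, hbs, hbc, hb⟩ := hzd.exists_countable
  obtain ⟨B, hB⟩ := (hbc.insert ∅).exists_eq_range (insert_nonempty _ _)
  have hBclopen : ∀ n, IsClopen (B n) := by
    intro n
    have : B n ∈ insert ∅ b := hB ▸ mem_range_self n
    rcases this with h | h
    · exact h ▸ isClopen_empty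
    · exact hbs h
  let ψ : Y → (ℕ → ZMod 2) := fun y n => if y ∈ B n then 1 else 0
  have hψ : Continuous ψ := by
    refine continuous_pi fun n => ?_
    refine continuous_const.if (fun y hy => ?_) continuous_const
    have hf : frontier {y | y ∈ B n} = ∅ := (hBclopen n).frontier_eq
    rw [hf] at hy
    exact hy.elim
  refine ⟨ψ, IsInducing.isEmbedding ?_⟩
  refine isInducing_iff_nhds.2 fun y => le_antisymm (hψ.tendsto y).le_comap fun U hU => ?_
  obtain ⟨V, hVb, hyV, hVU⟩ := hb.mem_nhds_iff.1 hU
  obtain ⟨n, rfl⟩ : V ∈ range B := hB ▸ mem_insert_of_mem _ hVb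
  refine ⟨{g | g n = 1}, ?_, fun z hz => hVU ?_⟩
  · refine IsOpen.mem_nhds ?_ (by simp [ψ, hyV])
    have hn : Continuous fun g : ℕ → ZMod 2 => g n := continuous_apply n
    exact (isOpen_discrete {1}).preimage hn
  · by_contra hzn
    simp [ψ, hzn] at hz

section Translates

variable {Y G : Type*} [AddCommGroup G] {ψ : Y → G}

/-- The graph-like translate of `ψ`, in the directions given by `s`, through `p`. -/
def cantorTranslate (ψ : Y → G) (p : G × (ℕ → G)) (s : ℕ → Bool) (y : Y) : G × (ℕ → G) :=
  (p.1 + ψ y, fun n => p.2 n + if s n then ψ y else 0)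

theorem isEmbedding_cantorTranslate [TopologicalSpace Y] [TopologicalSpace G]
    [IsTopologicalAddGroup G] (hψ : IsEmbedding ψ) (p : G × (ℕ → G)) (s : ℕ → Bool) :
    IsEmbedding (cantorTranslate ψ p s) := by
  refine IsEmbedding.of_comp (g := Prod.fst) ?_ continuous_fst
    ((Homeomorph.addLeft p.1).isEmbedding.comp hψ)
  refine (continuous_const.add hψ.continuous).prodMk (continuous_pi fun n => ?_)
  by_cases h : s n
  · simp only [h, if_true]
    exact continuous_const.add hψ.continuous
  · simpa [h] using continuous_const

/-- A translate not containing `p` meets at most one of the translates through `p`. -/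
theorem apply_eq_true_iff_of_inter_nonempty {p q : G × (ℕ → G)} {s t : ℕ → Bool}
    (hp : p ∉ range (cantorTranslate ψ q t))
    (h : (range (cantorTranslate ψ p s) ∩ range (cantorTranslate ψ q t)).Nonempty) (n : ℕ) :
    s n = true ↔ if t n then p.2 n - q.2 n = p.1 - q.1 else p.2 n - q.2 n ≠ 0 := by
  obtain ⟨_, ⟨y, rfl⟩, z, hz⟩ := h
  have hy : ψ y ≠ 0 := by
    intro hy
    refine hp ⟨z, hz.trans ?_⟩
    simp [cantorTranslate, hy]
  simp only [cantorTranslate, Prod.mk.injEq] at hz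
  obtain ⟨h1, h2⟩ := hz
  have h3 := congrFun h2 n
  have h4 : ψ z = p.1 - q.1 + ψ y := by
    rw [eq_sub_of_add_eq' h1]
    abel
  cases ht : t n <;> cases hs : s n <;>
    simp only [ht, hs, Bool.false_eq_true, if_true, if_false, add_zero, false_iff, true_iff] at h3 ⊢
  · simp [h3]
  · simpa [h3] using hy
  · rw [h4] at h3
    simp [← h3, hy]
  · rw [h4] at h3
    rw [sub_eq_iff_eq_add']
    exact (add_right_cancel (b := ψ y) (by rw [← h3]; abel)).symm

end Translates

/-- The Cantor group is homeomorphic to the Cantor space. -/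
def zmodHomeomorphCantor : (ℕ → ZMod 2) ≃ₜ (ℕ → Bool) :=
  Homeomorph.piCongrRight fun _ => (finTwoEquiv : ZMod 2 ≃ Bool).toHomeomorphOfDiscrete

/-- The Cantor space can be partitioned into copies of any nonempty zero-dimensional separable
metrizable space. -/
theorem isPartitionableSet_univ_cantor {Y : Type*} [TopologicalSpace Y] [T0Space Y]
    [SecondCountableTopology Y] [Nonempty Y]
    (hzd : IsTopologicalBasis {s : Set Y | IsClopen s}) :
    IsPartitionableSet Y (Set.univ : Set (ℕ → Bool)) := by
  obtain ⟨φ, hφ⟩ := exists_isEmbedding_cantor hzd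
  obtain ⟨y₀⟩ := ‹Nonempty Y›
  let ψ : Y → (ℕ → ZMod 2) := fun y => -φ y₀ + φ y
  have hψ : IsEmbedding ψ := (Homeomorph.addLeft (-φ y₀)).isEmbedding.comp hφ
  have hψ0 : ψ y₀ = 0 := neg_add_cancel _
  let e : (ℕ → ZMod 2) × (ℕ → ℕ → ZMod 2) ≃ₜ (ℕ → Bool) :=
    (zmodHomeomorphCantor.prodCongr
      ((Homeomorph.piCongrRight fun _ => zmodHomeomorphCantor).trans
        cantorSpaceHomeomorphNatToCantorSpace.symm)).trans cantorHomeomorphProd.symm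
  obtain ⟨P, hPC, hPd, hPU⟩ := exists_partition_of_forall_mk_lt
    {K | ∃ p s, K = range (cantorTranslate ψ p s)} fun x F hF hFX hx => by
      by_contra! hbad
      have hmeet : ∀ s : ℕ → Bool, ∃ L : F, (range (cantorTranslate ψ x s) ∩ L.1).Nonempty := by
        intro s
        have := hbad _ ⟨x, s, rfl⟩ ⟨y₀, by simp [cantorTranslate, hψ0]⟩
        rw [not_disjoint_iff_nonempty_inter] at this
        obtain ⟨y, hy, L, hL, hyL⟩ := this
        exact ⟨⟨L, hL⟩, y, hy, hyL⟩
      choose L hL using hmeet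
      have hinj : Function.Injective L := by
        intro s t hst
        obtain ⟨q, r, hqr⟩ := hF (L s).2
        have hxL : x ∉ (L s).1 := fun h => hx ⟨_, (L s).2, h⟩
        have h1 := hL s
        have h2 := hL t
        rw [← hst] at h2
        rw [hqr] at h1 h2 hxL
        funext n
        exact Bool.eq_iff_iff.2 ((apply_eq_true_iff_of_inter_nonempty hxL h1 n).trans
          (apply_eq_true_iff_of_inter_nonempty hxL h2 n).symm)
      have h1 := mk_le_of_injective hinj
      rw [← mk_congr e.toEquiv] at h1
      exact h1.not_gt hFX
  rw [← e.surjective.range_eq, ← image_univ]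
  refine IsPartitionableSet.image ⟨P, fun K hK => ?_, hPd, hPU⟩ e.isEmbedding
  obtain ⟨p, s, rfl⟩ := hPC hK
  exact ⟨_, isEmbedding_cantorTranslate hψ p s, rfl⟩

end ZeroDimensional

section CantorSubsets

open Metric

/-- In a complete metric space without isolated points every nonempty open set contains a Cantor
set. -/
theorem exists_isCopy_cantor_subset {X : Type*} [MetricSpace X] [CompleteSpace X]
    (hX : ∀ x : X, ¬IsOpen ({x} : Set X)) {U : Set X} (hU : IsOpen U) (hne : U.Nonempty) :
    ∃ K ⊆ U, IsCopy (ℕ → Bool) K := by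
  obtain ⟨x, hx⟩ := hne
  have _ : PerfectSpace X := perfectSpace_iff_forall_not_isolated.2 fun x =>
    ⟨fun h => hX x ((isOpen_singleton_iff_punctured_nhds x).2 h)⟩
  obtain ⟨ε, hε, hεU⟩ := Metric.nhds_basis_closedBall.mem_iff.1 (hU.mem_nhds hx)
  have hperf : Perfect (closure (ball x ε)) := by
    refine Preperfect.perfect_closure ?_
    simpa using (PerfectSpace.univ_preperfect (α := X)).open_inter isOpen_ball
  obtain ⟨f, hf, hfc, hfi⟩ := hperf.exists_nat_bool_injection
    ⟨x, subset_closure (mem_ball_self hε)⟩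
  exact ⟨range f, hf.trans (closure_ball_subset_closedBall.trans hεU), hfc.isCopy_range hfi⟩

theorem exists_isCopy_cantor_subset_of_coverable {X Y : Type*} [TopologicalSpace X]
    [TopologicalSpace Y] [PolishSpace Y] (hY : ∀ y : Y, ¬IsOpen ({y} : Set Y))
    (hXY : Coverable X Y) {U : Set X} (hU : IsOpen U) (hne : U.Nonempty) :
    ∃ K ⊆ U, IsCopy (ℕ → Bool) K := by
  obtain ⟨C, hC, hCU⟩ := hXY
  obtain ⟨x, hx⟩ := hne
  obtain ⟨K, hK, hxK⟩ : x ∈ ⋃₀ C := hCU ▸ mem_univ x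
  obtain ⟨f, hf, rfl⟩ := nonempty_homeomorph_iff_isCopy.1 (hC K hK)
  obtain ⟨y, rfl⟩ := hxK
  let _ := upgradeIsCompletelyMetrizable Y
  obtain ⟨L, hL, hLc⟩ := exists_isCopy_cantor_subset hY (hU.preimage hf.continuous) ⟨y, hx⟩
  exact ⟨f '' L, image_subset_iff.2 hL, hLc.image hf⟩

theorem Coverable.not_isOpen_singleton {X Y : Type*} [TopologicalSpace X]
    [TopologicalSpace Y] (hY : ∀ y : Y, ¬IsOpen ({y} : Set Y)) (hXY : Coverable X Y) (x : X) :
    ¬IsOpen ({x} : Set X) := by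
  intro hx
  obtain ⟨C, hC, hCU⟩ := hXY
  obtain ⟨K, hK, hxK⟩ : x ∈ ⋃₀ C := hCU ▸ mem_univ x
  obtain ⟨f, hf, rfl⟩ := nonempty_homeomorph_iff_isCopy.1 (hC K hK)
  obtain ⟨y, rfl⟩ := hxK
  refine hY y ?_
  have : f ⁻¹' {f y} = {y} := by
    ext z
    simp [hf.injective.eq_iff]
  exact this ▸ hx.preimage hf.continuous

end CantorSubsets

end Auxiliary

theorem stmt_18 (Y : Type*) [TopologicalSpace Y] [PolishSpace Y] [Nonempty Y]
    (hzd : IsTopologicalBasis {s : Set Y | IsClopen s})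
    (hni : ∀ y : Y, ¬ IsOpen ({y} : Set Y)) :
    -- (1) first countable Hausdorff spaces of size at most 𝔠
    (∀ (X : Type u) [TopologicalSpace X] [T2Space X] [FirstCountableTopology X],
      Cardinal.mk X ≤ Cardinal.continuum → (Partitionable X Y ↔ Coverable X Y)) ∧
    -- (2) metrizable spaces of size at most 𝔠^{+ω}
    (∀ (X : Type u) [TopologicalSpace X] [MetrizableSpace X],
      Cardinal.mk X ≤ contSuccOmega → (Partitionable X Y ↔ Coverable X Y)) ∧
    -- (3) completely metrizable spaces
    (∀ (X : Type u) [TopologicalSpace X], CompletelyMetrizable X →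
      ((Partitionable X Y ↔ Coverable X Y) ∧
        (Coverable X Y ↔ ∀ x : X, ¬ IsOpen ({x} : Set X)))) := by
  have hC : IsPartitionableSet Y (Set.univ : Set (ℕ → Bool)) :=
    isPartitionableSet_univ_cantor hzd
  refine ⟨fun X _ _ _ hX => ⟨Partitionable.coverable, fun h => partitionable_iff.2 ?_⟩,
    fun X _ _ hX => ⟨Partitionable.coverable, fun h => partitionable_iff.2 ?_⟩, ?_⟩
  · exact (isPartitionableSet_cantor_of_mk_le hX fun U hU hne =>
      exists_isCopy_cantor_subset_of_coverable hni h hU hne).trans hC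
  · let _ := metrizableSpaceMetric X
    exact (isPartitionableSet_cantor_of_mk_le_contSuccOmega hX fun U hU hne =>
      exists_isCopy_cantor_subset_of_coverable hni h hU hne).trans hC
  · rintro X _ ⟨m, rfl, _⟩
    have hpart (hX : ∀ x : X, ¬IsOpen ({x} : Set X)) : Partitionable X Y :=
      partitionable_iff.2 ((isPartitionableSet_cantor_of_completeSpace fun U hU hne =>
        exists_isCopy_cantor_subset hX hU hne).trans hC)
    exact ⟨⟨Partitionable.coverable, fun h => hpart (h.not_isOpen_singleton hni)⟩,
      fun h => h.not_isOpen_singleton hni, fun hX => (hpart hX).coverable⟩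
end

section
/- For any nonempty zero-dimensional Polish space Y (possibly with isolated points), every 2^ω-partitionable topological space is Y-partitionable. -/
open Cardinal Set TopologicalSpace

/-- A family of embeddings of `Y` into `X` whose ranges tile `X` yields a partition of `X`. -/
theorem partitionable_of_embeddings {X Y I : Type*} [TopologicalSpace X] [TopologicalSpace Y]
    (g : I → Y → X) (hg : ∀ i, Topology.IsEmbedding (g i))
    (hinj : ∀ i j y z, g i y = g j z → i = j) (hsurj : ∀ x, ∃ i y, g i y = x) :
    Partitionable X Y := by
  refine ⟨Set.range fun i => Set.range (g i), ?_, ?_, ?_⟩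
  · rintro _ ⟨i, rfl⟩
    exact ⟨(hg i).toHomeomorph.symm⟩
  · rintro _ ⟨i, rfl⟩ _ ⟨j, rfl⟩ hij
    refine Set.disjoint_left.2 ?_
    rintro _ ⟨y, rfl⟩ ⟨z, hz⟩
    exact hij (by rw [hinj _ _ _ _ hz])
  · refine Set.eq_univ_of_forall fun x => ?_
    obtain ⟨i, y, rfl⟩ := hsurj x
    exact ⟨_, ⟨i, rfl⟩, y, rfl⟩

/-- A partition of `X` into copies of `Z` composes with a tiling of `Z` by embedded copies
of `Y`. -/
theorem Partitionable.trans_embeddings {X Z Y J : Type*} [TopologicalSpace X]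
    [TopologicalSpace Z] [TopologicalSpace Y] (hX : Partitionable X Z)
    (m : J → Y → Z) (hm : ∀ j, Topology.IsEmbedding (m j))
    (hinj : ∀ i j y z, m i y = m j z → i = j) (hsurj : ∀ x, ∃ j y, m j y = x) :
    Partitionable X Y := by
  obtain ⟨P, hP, hdis, hcov⟩ := hX
  let h : ∀ K : P, Z ≃ₜ K.1 := fun K => (hP K.1 K.2).some.symm
  refine partitionable_of_embeddings
    (fun (p : P × J) y => ((h p.1 (m p.2 y) : p.1.1) : X)) ?_ ?_ ?_
  · rintro ⟨K, j⟩
    exact Topology.IsEmbedding.subtypeVal.comp ((h K).isEmbedding.comp (hm j))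
  · rintro ⟨K, i⟩ ⟨L, j⟩ y z heq
    dsimp only at heq
    have hKL : K = L := by
      by_contra hne
      refine Set.disjoint_left.1 (hdis K.2 L.2 fun hv => hne (Subtype.ext hv))
        (h K (m i y)).2 ?_
      change ((h K (m i y) : K.1) : X) ∈ L.1
      rw [heq]
      exact (h L (m j z)).2
    subst hKL
    rw [hinj i j y z ((h K).injective (Subtype.ext heq))]
  · intro x
    obtain ⟨K, hK, hx⟩ := (hcov.symm ▸ Set.mem_univ x : x ∈ ⋃₀ P)
    obtain ⟨j, y, hy⟩ := hsurj ((h ⟨K, hK⟩).symm ⟨x, hx⟩)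
    exact ⟨(⟨K, hK⟩, j), y, by simp [hy]⟩

/-- A zero-dimensional separable metric space has, at each scale, a continuous countable-valued
labelling whose fibres have small diameter. -/
theorem exists_continuous_nat_label {Y : Type*} [MetricSpace Y] [SecondCountableTopology Y]
    (hzd : IsTopologicalBasis {s : Set Y | IsClopen s}) {ε : ℝ} (hε : 0 < ε) :
    ∃ f : Y → ℕ, Continuous f ∧ ∀ a b, f a = f b → dist a b < ε := by
  classical
  rcases isEmpty_or_nonempty Y with hY | hY
  · exact ⟨fun _ => 0, continuous_const, fun a => (hY.false a).elim⟩
  have hloc : ∀ y : Y, ∃ s : Set Y, IsClopen s ∧ y ∈ s ∧ s ⊆ Metric.ball y (ε / 2) := fun y => by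
    obtain ⟨s, hs, hy, hsub⟩ := hzd.exists_subset_of_mem_open
      (Metric.mem_ball_self (half_pos hε)) (Metric.isOpen_ball (x := y) (ε := ε / 2))
    exact ⟨s, hs, hy, hsub⟩
  choose U hU hyU hUsub using hloc
  obtain ⟨T, hT, hcov⟩ := TopologicalSpace.countable_cover_nhds
    (f := U) fun y => (hU y).isOpen.mem_nhds (hyU y)
  have hTne : T.Nonempty := by
    obtain ⟨y⟩ := hY
    obtain ⟨t, ht, -⟩ := Set.mem_iUnion₂.1 (hcov.symm ▸ Set.mem_univ y : y ∈ ⋃ x ∈ T, U x)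
    exact ⟨t, ht⟩
  obtain ⟨c, rfl⟩ := hT.exists_eq_range hTne
  have hex : ∀ y, ∃ n, y ∈ U (c n) := fun y => by
    simpa using (hcov.symm ▸ Set.mem_univ y : y ∈ ⋃ x ∈ Set.range c, U x)
  refine ⟨fun y => Nat.find (hex y), ?_, fun a b hab => ?_⟩
  · refine continuous_discrete_rng.2 fun n => ?_
    have : (fun y => Nat.find (hex y)) ⁻¹' {n} = U (c n) ∩ ⋂ i ∈ Set.Iio n, (U (c i))ᶜ := by
      ext y
      simp [Nat.find_eq_iff]
    rw [this]
    exact (hU _).isOpen.inter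
      ((Set.finite_Iio n).isOpen_biInter fun i _ => (hU (c i)).compl.isOpen)
  · have ha := hUsub _ (Nat.find_spec (hex a))
    have hb := hUsub _ (Nat.find_spec (hex b))
    dsimp only at hab
    rw [← hab] at hb
    rw [Metric.mem_ball] at ha hb
    linarith [dist_triangle_right a b (c (Nat.find (hex a)))]

/-- A zero-dimensional Polish space is coded by a closed set of sequences of naturals. -/
theorem exists_nat_coding (Y : Type*) [TopologicalSpace Y] [PolishSpace Y]
    (hzd : IsTopologicalBasis {s : Set Y | IsClopen s}) :
    ∃ f : ℕ → Y → ℕ, (∀ n, Continuous (f n)) ∧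
      (∀ y, ∀ s ∈ nhds y, ∃ n, ∀ z, f n z = f n y → z ∈ s) ∧
      ∀ v : ℕ → Y, (∀ n, ∀ i < n, f i (v (n + 1)) = f i (v n)) →
        ∃ y, ∀ n, ∀ i < n, f i y = f i (v n) := by
  let := TopologicalSpace.upgradeIsCompletelyMetrizable Y
  choose f hf hdist using fun n : ℕ =>
    exists_continuous_nat_label hzd (ε := (1 / 2 : ℝ) ^ n) (by positivity)
  refine ⟨f, hf, fun y s hs => ?_, fun v hv => ?_⟩
  · obtain ⟨ε, hε, hsub⟩ := Metric.mem_nhds_iff.1 hs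
    obtain ⟨n, hn⟩ := exists_pow_lt_of_lt_one hε (by norm_num : (1 / 2 : ℝ) < 1)
    exact ⟨n, fun z hz => hsub ((hdist n z y hz).trans hn)⟩
  · have hstab : ∀ i n m, i < n → n ≤ m → f i (v m) = f i (v n) := by
      intro i n m hin hnm
      induction m, hnm using Nat.le_induction with
      | base => rfl
      | succ m hm ih => rw [hv m i (hin.trans_le hm), ih]
    have hc : CauchySeq v := by
      refine Metric.cauchySeq_iff'.2 fun ε hε => ?_
      obtain ⟨n, hn⟩ := exists_pow_lt_of_lt_one hε (by norm_num : (1 / 2 : ℝ) < 1)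
      exact ⟨n + 1, fun m hm => (hdist n _ _ (hstab n (n + 1) m n.lt_succ_self hm)).trans hn⟩
    obtain ⟨y, hy⟩ := cauchySeq_tendsto_of_complete hc
    refine ⟨y, fun n i hin => ?_⟩
    refine tendsto_nhds_unique (((hf i).tendsto y).comp hy) ?_
    refine tendsto_const_nhds.congr' ?_
    filter_upwards [Filter.eventually_ge_atTop n] with m hm
    exact (hstab i n m hin hm).symm

/-- For each nonempty set `S` of naturals, `S × 2^ω` and `2^ω` are equinumerous. -/
theorem exists_prod_cantorSpace_bijection (S : Set ℕ) (hS : S.Nonempty) :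
    ∃ e : ℕ → CantorSpace → CantorSpace,
      (∀ k ∈ S, ∀ l ∈ S, ∀ c d, e k c = e l d → k = l ∧ c = d) ∧
      ∀ u, ∃ k ∈ S, ∃ c, e k c = u := by
  classical
  have : Nonempty S := hS.to_subtype
  have hcard : #(S × CantorSpace) = #CantorSpace := by
    rw [Cardinal.mk_prod, Cardinal.lift_id, Cardinal.lift_id]
    refine Cardinal.mul_eq_right (Cardinal.aleph0_le_mk _)
      ((Cardinal.mk_le_aleph0).trans (Cardinal.aleph0_le_mk _)) (Cardinal.mk_ne_zero _)
  obtain ⟨E⟩ := Cardinal.eq.1 hcard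
  refine ⟨fun k c => if h : k ∈ S then E (⟨k, h⟩, c) else c, ?_, fun u => ?_⟩
  · intro k hk l hl c d h
    simpa [hk, hl] using h
  · exact ⟨(E.symm u).1, (E.symm u).1.2, (E.symm u).2, by simp⟩

/-- `2^ω` (as `(2^ω)^ω`) is partitioned by continuous injective images of any nonempty
zero-dimensional Polish space. -/
theorem exists_continuous_tiling {Y : Type*} [TopologicalSpace Y] [Nonempty Y]
    (f : ℕ → Y → ℕ) (hf : ∀ n, Continuous (f n))
    (hsep : ∀ y z, (∀ n, f n y = f n z) → y = z)
    (hcomp : ∀ v : ℕ → Y, (∀ n, ∀ i < n, f i (v (n + 1)) = f i (v n)) →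
        ∃ y, ∀ n, ∀ i < n, f i y = f i (v n)) :
    ∃ φ : (ℕ → CantorSpace) → Y → (ℕ → CantorSpace), (∀ w, Continuous (φ w)) ∧
      (∀ w w' y y', φ w y = φ w' y' → w = w' ∧ y = y') ∧ ∀ u, ∃ w y, φ w y = u := by
  let S : ℕ → Y → Set ℕ := fun n y => {k | ∃ z, (∀ i < n, f i z = f i y) ∧ f n z = k}
  have hmem : ∀ n y, f n y ∈ S n y := fun n y => ⟨y, fun _ _ => rfl, rfl⟩
  have hScongr : ∀ n y z, (∀ i < n, f i y = f i z) → S n y = S n z := by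
    intro n y z h
    ext k
    exact exists_congr fun a => and_congr_left' (forall₂_congr fun i hi => by rw [h i hi])
  choose! e heinj hesurj using exists_prod_cantorSpace_bijection
  refine ⟨fun w y n => e (S n y) (f n y) (w n), fun w => ?_, fun w w' y y' h => ?_, fun u => ?_⟩
  · refine continuous_pi fun n => IsLocallyConstant.continuous ?_
    refine (IsLocallyConstant.iff_eventually_eq _).2 fun y => ?_
    have hev : ∀ᶠ z in nhds y, ∀ i ∈ Set.Iio (n + 1), f i z = f i y :=
      (Filter.eventually_all_finite (Set.finite_Iio (n + 1))).2 fun i _ =>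
        ((IsLocallyConstant.iff_continuous _).2 (hf i)).eventually_eq y
    filter_upwards [hev] with z hz
    rw [hScongr n z y fun i hi => hz i (hi.trans n.lt_succ_self), hz n n.lt_succ_self]
  · have key : ∀ n, f n y = f n y' ∧ w n = w' n := by
      intro n
      induction n using Nat.strong_induction_on with
      | _ n ih =>
        have hS := hScongr n y y' fun i hi => (ih i hi).1
        have hn : e (S n y) (f n y) (w n) = e (S n y') (f n y') (w' n) := congrFun h n
        rw [← hS] at hn
        exact heinj _ ⟨_, hmem n y⟩ _ (hmem n y) _ (hS ▸ hmem n y') _ _ hn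
    exact ⟨funext fun n => (key n).2, hsep _ _ fun n => (key n).1⟩
  · have hstep : ∀ n y, ∃ z c, (∀ i < n, f i z = f i y) ∧ e (S n y) (f n z) c = u n := by
      intro n y
      obtain ⟨k, ⟨z, hz, rfl⟩, c, hc⟩ := hesurj (S n y) ⟨_, hmem n y⟩ (u n)
      exact ⟨z, c, hz, hc⟩
    choose g c hg hc using hstep
    let v : ℕ → Y := fun n => Nat.rec (Classical.arbitrary Y) g n
    obtain ⟨y, hy⟩ := hcomp v fun n => hg n (v n)
    refine ⟨fun n => c n (v n), y, funext fun n => ?_⟩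
    dsimp only
    rw [hScongr n y (v n) (hy n), hy (n + 1) n n.lt_succ_self]
    exact hc n (v n)

/-- The Cantor space is homeomorphic to the product of two of its countable powers. -/
theorem nonempty_prod_homeomorph_cantorSpace :
    Nonempty ((ℕ × ℕ → Bool) × (ℕ → CantorSpace) ≃ₜ CantorSpace) := by
  have e : (ℕ × ℕ) ⊕ (ℕ × ℕ) ≃ ℕ := Classical.choice (nonempty_equiv_of_countable)
  have curry : (ℕ → CantorSpace) ≃ₜ (ℕ × ℕ → Bool) :=
    { toEquiv := (Equiv.curry ℕ ℕ Bool).symm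
      continuous_toFun := by
        refine continuous_pi fun p => ?_
        exact (continuous_apply p.2).comp (continuous_apply p.1)
      continuous_invFun := by
        refine continuous_pi fun i => continuous_pi fun j => ?_
        exact continuous_apply (i, j) }
  exact ⟨((Homeomorph.refl _).prodCongr curry).trans
    (Homeomorph.sumArrowHomeomorphProdArrow.symm.trans
      (Homeomorph.piCongrLeft (Y := fun _ => Bool) e))⟩

theorem stmt_19 (Y : Type*) [TopologicalSpace Y] [PolishSpace Y] [Nonempty Y]
    (hzd : IsTopologicalBasis {s : Set Y | IsClopen s}) :
    ∀ (X : Type u) [TopologicalSpace X],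
      Partitionable X CantorSpace → Partitionable X Y := by
  intro X _ hX
  obtain ⟨f, hf, hnhds, hcomp⟩ := exists_nat_coding Y hzd
  have hsep : ∀ y z, (∀ n, f n y = f n z) → y = z := fun y z h => by
    by_contra hne
    obtain ⟨n, hn⟩ := hnhds y {z}ᶜ (isOpen_compl_singleton.mem_nhds hne)
    exact hn z (h n).symm rfl
  obtain ⟨φ, hφ, hφinj, hφsurj⟩ := exists_continuous_tiling f hf hsep hcomp
  obtain ⟨H⟩ := nonempty_prod_homeomorph_cantorSpace
  let ι : Y → ℕ × ℕ → Bool := fun y p => decide (f p.1 y = p.2)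
  let g : (ℕ × ℕ → Bool) × (ℕ → CantorSpace) → Y → (ℕ × ℕ → Bool) × (ℕ → CantorSpace) :=
    fun a y => (fun p => xor (a.1 p) (ι y p), φ a.2 y)
  have hg : ∀ a, Topology.IsEmbedding (g a) := by
    intro a
    have hcont : Continuous (g a) := by
      refine Continuous.prodMk (continuous_pi fun p => ?_) (hφ a.2)
      exact (continuous_of_discreteTopology (f := fun k : ℕ => xor (a.1 p) (decide (k = p.2)))).comp
        (hf p.1)
    refine ⟨Topology.isInducing_iff_nhds.2 fun y => le_antisymm hcont.continuousAt.le_comap ?_,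
      fun y z h => (hφinj _ _ _ _ (congrArg Prod.snd h)).2⟩
    intro s hs
    obtain ⟨n, hn⟩ := hnhds y s hs
    refine ⟨{q | q.1 (n, f n y) = (g a y).1 (n, f n y)}, ?_, fun z hz => hn z ?_⟩
    · have hq : Continuous fun q : (ℕ × ℕ → Bool) × (ℕ → CantorSpace) => q.1 (n, f n y) :=
        (continuous_apply _).comp continuous_fst
      exact (isOpen_discrete {(g a y).1 (n, f n y)}).preimage hq |>.mem_nhds rfl
    · have hι : ι z (n, f n y) = ι y (n, f n y) := Bool.xor_right_inj.1 hz
      simpa [ι] using hι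
  refine hX.trans_embeddings (fun a y => H (g a y)) (fun a => H.isEmbedding.comp (hg a)) ?_ ?_
  · intro a b y z h
    have h' := H.injective h
    obtain ⟨hw, rfl⟩ := hφinj _ _ _ _ (congrArg Prod.snd h')
    refine Prod.ext (funext fun p => ?_) hw
    simpa [g] using congrFun (congrArg Prod.fst h') p
  · intro x
    obtain ⟨w, y, hy⟩ := hφsurj (H.symm x).2
    refine ⟨(fun p => xor ((H.symm x).1 p) (ι y p), w), y, ?_⟩
    rw [← H.eq_symm_apply]
    refine Prod.ext (funext fun p => ?_) hy
    simp [g]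
end
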